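/- arXiv:math/0107171 — 2 statements merged into one kernel-verified Lean document; each statement's English description precedes it below -/
import Mathlib

section
/- Let Z be a metric space homeomorphic to the 2-sphere. If Z is LLC, then Z is linearly locally contractible (with contractibility constant depending on Z, not just the LLC constant). -/
/-- A continuum: a compact connected set with more than one point. -/
def IsContinuum {Z : Type*} [MetricSpace Z] (E : Set Z) : Prop :=
  IsCompact E ∧ IsConnected E ∧ E.Nontrivial

/-- The distance between two subsets of a metric space. -/
noncomputable def setDist {Z : Type*} [MetricSpace Z] (E F : Set Z) : ℝ :=
  sInf (Set.image2 dist E F)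

/-- The relative distance `Δ(E,F) = dist(E,F)/min(diam E, diam F)`. -/
noncomputable def relDelta {Z : Type*} [MetricSpace Z] (E F : Set Z) : ℝ :=
  setDist E F / min (Metric.diam E) (Metric.diam F)

/-- The cross-ratio of four points in a metric space. -/
noncomputable def crossRatio {Z : Type*} [MetricSpace Z] (z1 z2 z3 z4 : Z) : ℝ :=
  (dist z1 z3 * dist z2 z4) / (dist z1 z4 * dist z2 z3)

/-- `Z` is `λ`-LLC: (LLC₁) any two points of `B(a,r)` lie in a continuum inside `B(a,λr)`,
and (LLC₂) any two points outside `B(a,r)` lie in a continuum inside `Z \ B(a, r/λ)`. -/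
def IsLLC (Z : Type*) [MetricSpace Z] (lam : ℝ) : Prop :=
  (∀ (a : Z) (r : ℝ), ∀ x ∈ Metric.ball a r, ∀ y ∈ Metric.ball a r,
      ∃ E : Set Z, IsContinuum E ∧ E ⊆ Metric.ball a (lam * r) ∧ x ∈ E ∧ y ∈ E) ∧
  (∀ (a : Z) (r : ℝ), ∀ x ∉ Metric.ball a r, ∀ y ∉ Metric.ball a r,
      ∃ E : Set Z, IsContinuum E ∧ E ⊆ (Metric.ball a (r / lam))ᶜ ∧ x ∈ E ∧ y ∈ E)

/-- `U` is contractible inside `V`: there is a continuous map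
`H : U × [0,1] → V` with `H(·,0) = id` and `H(·,1)` constant. -/
def ContractibleInside {Z : Type*} [MetricSpace Z] (U V : Set Z) : Prop :=
  ∃ H : Z × ℝ → Z, ContinuousOn H (U ×ˢ Set.Icc (0:ℝ) 1) ∧
    (∀ x ∈ U, H (x, 0) = x) ∧ (∃ z : Z, ∀ x ∈ U, H (x, 1) = z) ∧
    (∀ x ∈ U, ∀ t ∈ Set.Icc (0:ℝ) 1, H (x, t) ∈ V)

/-- `Z` is `λ`-linearly locally contractible: every ball `B(a,r)` with
`0 < r ≤ diam(Z)/λ` is contractible inside `B(a, λr)`. -/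
def LinLocContractible (Z : Type*) [MetricSpace Z] (lam : ℝ) : Prop :=
  ∀ (a : Z) (r : ℝ), 0 < r → r ≤ Metric.diam (Set.univ : Set Z) / lam →
    ContractibleInside (Metric.ball a r) (Metric.ball a (lam * r))

open Set Metric

/-! ### Extensors -/

/-- Every continuous map from a closed subset of `Y` into `X` extends to a continuous map from `Y`
into `X`. -/
def IsExtensor (Y : Type*) [TopologicalSpace Y] {E : Type*} [TopologicalSpace E]
    (X : Set E) : Prop :=
  ∀ (A : Set Y) (f : Y → E), IsClosed A → ContinuousOn f A → MapsTo f A X →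
    ∃ g : Y → E, Continuous g ∧ (∀ y, g y ∈ X) ∧ EqOn g f A

/-- A nonempty closed rectangle is an extensor, by Tietze's theorem. -/
theorem isExtensor_Icc (Y : Type) [TopologicalSpace Y] [NormalSpace Y] {a b : ℝ × ℝ}
    (hab : a ≤ b) : IsExtensor Y (Icc a b) := by
  intro A f hA hf hfX
  obtain ⟨F, hF⟩ := ContinuousMap.exists_restrict_eq hA ⟨A.domRestrict f, hf.domRestrict⟩
  have hF' : ∀ y ∈ A, F y = f y := fun y hy => congrArg (fun g => g ⟨y, hy⟩) hF
  refine ⟨fun y => a ⊔ (F y ⊓ b), ?_,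
    fun y => ⟨le_sup_left, sup_le hab inf_le_right⟩, ?_⟩
  · change Continuous fun y => (a.1 ⊔ ((F y).1 ⊓ b.1), a.2 ⊔ ((F y).2 ⊓ b.2))
    fun_prop
  intro y hy
  have h := hfX hy
  simp only [hF' y hy, inf_eq_left.2 h.2, sup_eq_right.2 h.1]

/-- The union of two closed extensors is an extensor if their intersection is one. -/
theorem IsExtensor.union {Y : Type*} [MetricSpace Y] {E : Type*} [TopologicalSpace E]
    {X₁ X₂ : Set E} (h₁ : IsExtensor Y X₁) (h₂ : IsExtensor Y X₂)
    (h : IsExtensor Y (X₁ ∩ X₂)) (hc₁ : IsClosed X₁) (hc₂ : IsClosed X₂) :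
    IsExtensor Y (X₁ ∪ X₂) := by
  classical
  intro A f hA hf hfX
  set A₁ := A ∩ f ⁻¹' X₁ with hA₁
  set A₂ := A ∩ f ⁻¹' X₂ with hA₂
  have cA₁ : IsClosed A₁ := hf.preimage_isClosed_of_isClosed hA hc₁
  have cA₂ : IsClosed A₂ := hf.preimage_isClosed_of_isClosed hA hc₂
  set Y₁ := {y : Y | infEDist y A₁ ≤ infEDist y A₂} with hY₁
  set Y₂ := {y : Y | infEDist y A₂ ≤ infEDist y A₁} with hY₂
  have cY₁ : IsClosed Y₁ := isClosed_le continuous_infEDist continuous_infEDist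
  have cY₂ : IsClosed Y₂ := isClosed_le continuous_infEDist continuous_infEDist
  have sub₁ : A₁ ⊆ Y₁ := fun y hy => by
    simp [hY₁, (mem_iff_infEDist_zero_of_closed cA₁).1 hy]
  have sub₂ : A₂ ⊆ Y₂ := fun y hy => by
    simp [hY₂, (mem_iff_infEDist_zero_of_closed cA₂).1 hy]
  have int₁ : ∀ y ∈ A₁, y ∈ Y₂ → y ∈ A₂ := fun y hy hy' => by
    rw [mem_iff_infEDist_zero_of_closed cA₂]
    simpa [hY₂, (mem_iff_infEDist_zero_of_closed cA₁).1 hy] using hy'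
  have int₂ : ∀ y ∈ A₂, y ∈ Y₁ → y ∈ A₁ := fun y hy hy' => by
    rw [mem_iff_infEDist_zero_of_closed cA₁]
    simpa [hY₁, (mem_iff_infEDist_zero_of_closed cA₂).1 hy] using hy'
  obtain ⟨g₀, g₀c, g₀X, g₀f⟩ := h (A₁ ∩ A₂) f (cA₁.inter cA₂)
    (hf.mono fun y hy => hy.1.1) fun y hy => ⟨hy.1.2, hy.2.2⟩
  have extend : ∀ (B : Set Y) (X : Set E), IsExtensor Y X → IsClosed B → B ⊆ A → MapsTo f B X →
      X₁ ∩ X₂ ⊆ X → (∀ y ∈ B, y ∈ Y₁ ∩ Y₂ → y ∈ A₁ ∩ A₂) →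
      ∃ g : Y → E, Continuous g ∧ (∀ y, g y ∈ X) ∧ EqOn g f B ∧ EqOn g g₀ (Y₁ ∩ Y₂) := by
    intro B X hX hB hBA hfB hXX hBY
    have e₁ : EqOn (B.piecewise f g₀) f B := fun y hy => piecewise_eq_of_mem _ _ _ hy
    have e₂ : EqOn (B.piecewise f g₀) g₀ (Y₁ ∩ Y₂) := fun y hy => by
      by_cases hyB : y ∈ B
      · rw [e₁ hyB, g₀f (hBY y hyB hy)]
      · exact piecewise_eq_of_notMem _ _ _ hyB
    obtain ⟨g, gc, gX, gf⟩ := hX (B ∪ Y₁ ∩ Y₂) (B.piecewise f g₀) (hB.union (cY₁.inter cY₂))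
      (((hf.mono hBA).congr e₁).union_of_isClosed (g₀c.continuousOn.congr e₂) hB
        (cY₁.inter cY₂)) (by
          rintro y (hy | hy)
          · rw [e₁ hy]; exact hfB hy
          · rw [e₂ hy]; exact hXX (g₀X y))
    exact ⟨g, gc, gX, fun y hy => (gf (Or.inl hy)).trans (e₁ hy),
      fun y hy => (gf (Or.inr hy)).trans (e₂ hy)⟩
  obtain ⟨g₁, g₁c, g₁X, g₁f, g₁g⟩ := extend A₁ X₁ h₁ cA₁ inter_subset_left (fun y hy => hy.2)
    inter_subset_left fun y hy hy' => ⟨hy, int₁ y hy hy'.2⟩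
  obtain ⟨g₂, g₂c, g₂X, g₂f, g₂g⟩ := extend A₂ X₂ h₂ cA₂ inter_subset_left (fun y hy => hy.2)
    inter_subset_right fun y hy hy' => ⟨int₂ y hy hy'.1, hy⟩
  have e₁ : EqOn (Y₁.piecewise g₁ g₂) g₁ Y₁ := fun y hy => piecewise_eq_of_mem _ _ _ hy
  have e₂ : EqOn (Y₁.piecewise g₁ g₂) g₂ Y₂ := fun y hy => by
    by_cases hy' : y ∈ Y₁
    · rw [e₁ hy', g₁g ⟨hy', hy⟩, g₂g ⟨hy', hy⟩]
    · exact piecewise_eq_of_notMem _ _ _ hy'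
  refine ⟨Y₁.piecewise g₁ g₂, ?_, fun y => ?_, fun y hy => ?_⟩
  · have hu : Y₁ ∪ Y₂ = univ := eq_univ_of_forall fun y =>
      le_total (infEDist y A₁) (infEDist y A₂)
    rw [← continuousOn_univ, ← hu]
    exact (g₁c.continuousOn.congr e₁).union_of_isClosed (g₂c.continuousOn.congr e₂) cY₁ cY₂
  · by_cases hy : y ∈ Y₁
    · rw [e₁ hy]; exact Or.inl (g₁X y)
    · rw [piecewise_eq_of_notMem _ _ _ hy]; exact Or.inr (g₂X y)
  · rcases hfX hy with h' | h'
    · rw [e₁ (sub₁ ⟨hy, h'⟩), g₁f ⟨hy, h'⟩]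
    · rw [e₂ (sub₂ ⟨hy, h'⟩), g₂f ⟨hy, h'⟩]

/-- A finite family of closed sets whose nonempty pairwise intersections are extensors and whose
intersection graph is a forest: every edge `{i, j}` is cut by an integer function that is constant
across all other edges. A preconnected set covered by the family is covered by a subfamily
whose union is an extensor. -/
theorem exists_isExtensor_biUnion {Y : Type*} [MetricSpace Y] {E : Type*} [TopologicalSpace E]
    {ι : Type*} [Finite ι] {R : ι → Set E} (hR : ∀ i, IsClosed (R i))
    (hI : ∀ i j, (R i ∩ R j).Nonempty → IsExtensor Y (R i ∩ R j))
    (hcut : ∀ i j, i ≠ j → (R i ∩ R j).Nonempty → ∃ n : ι → ℤ, n i ≠ n j ∧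
      ∀ k l, (R k ∩ R l).Nonempty → n k ≠ n l → (k = i ∧ l = j) ∨ (k = j ∧ l = i))
    {K : Set E} (hK : IsPreconnected K) (hne : K.Nonempty) (hKR : K ⊆ ⋃ i, R i) :
    ∃ s : Set ι, K ⊆ ⋃ i ∈ s, R i ∧ IsExtensor Y (⋃ i ∈ s, R i) := by
  obtain ⟨x₀, hx₀⟩ := hne
  obtain ⟨i₀, hi₀⟩ := mem_iUnion.1 (hKR hx₀)
  let good : Set (Set ι) := {s | i₀ ∈ s ∧
    (∀ n : ι → ℤ, (∀ k ∈ s, ∀ l ∈ s, (R k ∩ R l).Nonempty → n k = n l) →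
      ∀ k ∈ s, ∀ l ∈ s, n k = n l) ∧ IsExtensor Y (⋃ i ∈ s, R i)}
  have h₀ : {i₀} ∈ good := by
    refine ⟨rfl, ?_, ?_⟩
    · rintro n - k rfl l rfl; rfl
    · simpa using hI i₀ i₀ ⟨x₀, hi₀, hi₀⟩
  obtain ⟨s, hs⟩ := (toFinite good).exists_maximal ⟨_, h₀⟩
  obtain ⟨hi₀s, hconst, hext⟩ := hs.prop
  have cl : ∀ t : Set ι, IsClosed (⋃ i ∈ t, R i) := fun t =>
    (toFinite t).isClosed_biUnion fun i _ => hR i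
  have closed_adj : ∀ i ∈ s, ∀ j, (R i ∩ R j).Nonempty → j ∈ s := by
    intro i hi j hij
    by_contra hj
    have hne : i ≠ j := fun h => hj (h ▸ hi)
    have hmeet : R j ∩ ⋃ k ∈ s, R k = R i ∩ R j := by
      ext x
      simp only [mem_inter_iff, mem_iUnion, exists_prop]
      refine ⟨?_, fun h => ⟨h.2, i, hi, h.1⟩⟩
      rintro ⟨hxj, k, hk, hxk⟩
      by_cases hki : k = i
      · exact ⟨hki ▸ hxk, hxj⟩
      exfalso
      obtain ⟨n, hn, hn'⟩ := hcut i j hne hij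
      have hs' : n i = n k := by
        refine hconst n (fun k hk l hl hkl => ?_) i hi k hk
        by_contra h
        rcases hn' k l hkl h with ⟨-, rfl⟩ | ⟨rfl, -⟩ <;> exact hj ‹_›
      have hkj : n k = n j := by
        by_contra h
        rcases hn' k j ⟨x, hxk, hxj⟩ h with ⟨h, -⟩ | ⟨rfl, -⟩
        · exact hki h
        · exact hj hk
      exact hn (hs'.trans hkj)
    have hins : insert j s ∈ good := by
      refine ⟨Or.inr hi₀s, fun n hn => ?_, ?_⟩
      · have hs' := hconst n fun k hk l hl => hn k (Or.inr hk) l (Or.inr hl)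
        have hj' : ∀ k ∈ insert j s, n k = n i := by
          rintro k (rfl | hk)
          · exact (hn i (Or.inr hi) k (Or.inl rfl) hij).symm
          · exact hs' k hk i hi
        exact fun k hk l hl => (hj' k hk).trans (hj' l hl).symm
      · rw [biUnion_insert]
        refine IsExtensor.union ?_ hext ?_ (hR j) (cl s)
        · obtain ⟨x, -, hx⟩ := hij
          simpa using hI j j ⟨x, hx, hx⟩
        · rw [hmeet]; exact hI i j hij
    exact hj (hs.le_of_ge hins (subset_insert j s) (mem_insert j s))
  refine ⟨s, fun x hx => ?_, hext⟩
  by_contra hxs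
  have hcover : K ⊆ (⋃ i ∈ s, R i) ∪ ⋃ i ∈ sᶜ, R i := fun y hy => by
    obtain ⟨i, hi⟩ := mem_iUnion.1 (hKR hy)
    by_cases his : i ∈ s
    · exact Or.inl (mem_biUnion his hi)
    · exact Or.inr (mem_biUnion his hi)
  obtain ⟨y, -, hy, hy'⟩ := isPreconnected_closed_iff.1 hK _ _ (cl s) (cl sᶜ) hcover
    ⟨x₀, hx₀, mem_biUnion hi₀s hi₀⟩ ⟨x, hx, (hcover hx).resolve_left hxs⟩
  simp only [mem_iUnion, exists_prop] at hy hy'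
  obtain ⟨i, hi, hyi⟩ := hy
  obtain ⟨j, hj, hyj⟩ := hy'
  exact hj (closed_adj i hi j ⟨y, hyi, hyj⟩)

/-! ### Grid cells and the outer region -/

/-- The closed unit cell of the integer grid with lower left corner `(i, j)`. -/
def gridCell (i j : ℤ) : Set (ℝ × ℝ) := Icc ((i : ℝ), (j : ℝ)) ((i : ℝ) + 1, (j : ℝ) + 1)

theorem mem_gridCell {i j : ℤ} {z : ℝ × ℝ} :
    z ∈ gridCell i j ↔ ((i : ℝ) ≤ z.1 ∧ z.1 ≤ i + 1) ∧ ((j : ℝ) ≤ z.2 ∧ z.2 ≤ j + 1) := by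
  simp only [gridCell, mem_Icc, Prod.le_def]
  tauto

theorem mem_gridCell_floor (z : ℝ × ℝ) : z ∈ gridCell ⌊z.1⌋ ⌊z.2⌋ :=
  mem_gridCell.2 ⟨⟨Int.floor_le _, (Int.lt_floor_add_one _).le⟩,
    ⟨Int.floor_le _, (Int.lt_floor_add_one _).le⟩⟩

/-- The cells reachable, through edge-adjacent cells not in `P`, from a cell outside the box
`[-N, N]²`. -/
inductive OuterCell (P : Set (ℤ × ℤ)) (N : ℤ) : ℤ → ℤ → Prop
  | far {i j : ℤ} : N < |i| ∨ N < |j| → OuterCell P N i j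
  | horizontal {i i' j : ℤ} : OuterCell P N i j → i' = i + 1 ∨ i = i' + 1 → (i', j) ∉ P →
      OuterCell P N i' j
  | vertical {i j j' : ℤ} : OuterCell P N i j → j' = j + 1 ∨ j = j' + 1 → (i, j') ∉ P →
      OuterCell P N i j'

theorem finite_not_outerCell (P : Set (ℤ × ℤ)) (N : ℤ) :
    {c : ℤ × ℤ | ¬ OuterCell P N c.1 c.2}.Finite := by
  refine (finite_Icc ((-N, -N) : ℤ × ℤ) (N, N)).subset fun c hc => ?_
  have h₁ : ¬ (N < |c.1| ∨ N < |c.2|) := fun h => hc (.far h)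
  push Not at h₁
  exact ⟨⟨(abs_le.1 h₁.1).1, (abs_le.1 h₁.2).1⟩, ⟨(abs_le.1 h₁.1).2, (abs_le.1 h₁.2).2⟩⟩

theorem not_outerCell_of_mem {P : Set (ℤ × ℤ)} {N : ℤ}
    (hN : ∀ c ∈ P, |c.1| ≤ N ∧ |c.2| ≤ N) {i j : ℤ} (hP : (i, j) ∈ P) : ¬ OuterCell P N i j := by
  rintro (h | h | h)
  · have := hN _ hP
    rcases h with h | h <;> simp only at this <;> omega
  · contradiction
  · contradiction

/-- Two cells sharing a point outside the cells of `P` are both outer or both not. -/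
theorem OuterCell.of_mem_gridCell {P : Set (ℤ × ℤ)} {N i j i' j' : ℤ} {z : ℝ × ℝ}
    (hz : ∀ c ∈ P, z ∉ gridCell c.1 c.2) (h : OuterCell P N i j) (hi : z ∈ gridCell i j)
    (hi' : z ∈ gridCell i' j') : OuterCell P N i' j' := by
  obtain ⟨⟨a₁, a₂⟩, a₃, a₄⟩ := mem_gridCell.1 hi
  obtain ⟨⟨b₁, b₂⟩, b₃, b₄⟩ := mem_gridCell.1 hi'
  have hmid : z ∈ gridCell i' j := mem_gridCell.2 ⟨⟨b₁, b₂⟩, a₃, a₄⟩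
  have e₁ : i ≤ i' + 1 := by exact_mod_cast a₁.trans b₂
  have e₂ : i' ≤ i + 1 := by exact_mod_cast b₁.trans a₂
  have e₃ : j ≤ j' + 1 := by exact_mod_cast a₃.trans b₄
  have e₄ : j' ≤ j + 1 := by exact_mod_cast b₃.trans a₄
  have h' : OuterCell P N i' j := by
    rcases eq_or_ne i' i with rfl | hne
    · exact h
    · exact h.horizontal (by omega) fun hP => hz _ hP hmid
  rcases eq_or_ne j' j with rfl | hne
  · exact h'
  · exact h'.vertical (by omega) fun hP => hz _ hP hi'

/-! ### Vertical runs of cells -/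

/-- A maximal vertical run of cells, in the column `col`, between the heights `lo` and `hi`, that
do not satisfy `O`. -/
@[ext]
structure CellRun (O : ℤ → ℤ → Prop) where
  col : ℤ
  lo : ℤ
  hi : ℤ
  lo_le_hi : lo ≤ hi
  not_mem : ∀ j, lo ≤ j → j ≤ hi → ¬ O col j
  below : O col (lo - 1)
  above : O col (hi + 1)

namespace CellRun

variable {O : ℤ → ℤ → Prop}

/-- The rectangle filled by a run. -/
def rect (R : CellRun O) : Set (ℝ × ℝ) :=
  Icc ((R.col : ℝ), (R.lo : ℝ)) ((R.col : ℝ) + 1, (R.hi : ℝ) + 1)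

/-- The rectangles of two runs intersect. -/
def Touch (R R' : CellRun O) : Prop :=
  (R.col ≤ R'.col + 1 ∧ R'.col ≤ R.col + 1) ∧ R.lo ≤ R'.hi + 1 ∧ R'.lo ≤ R.hi + 1

theorem touch_of_nonempty {R R' : CellRun O} (h : (R.rect ∩ R'.rect).Nonempty) : R.Touch R' := by
  obtain ⟨z, ⟨⟨a₁, a₂⟩, a₃, a₄⟩, ⟨b₁, b₂⟩, b₃, b₄⟩ := h
  simp only at a₁ a₂ a₃ a₄ b₁ b₂ b₃ b₄
  exact ⟨⟨by exact_mod_cast a₁.trans b₃, by exact_mod_cast b₁.trans a₃⟩,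
    by exact_mod_cast a₂.trans b₄, by exact_mod_cast b₂.trans a₄⟩

theorem Touch.symm {R R' : CellRun O} (h : R.Touch R') : R'.Touch R :=
  ⟨⟨h.1.2, h.1.1⟩, h.2.2, h.2.1⟩

/-- Touching runs in the same column coincide. -/
theorem Touch.eq_of_col_eq {R R' : CellRun O} (h : R.Touch R') (hc : R.col = R'.col) : R = R' := by
  obtain ⟨-, h₁, h₂⟩ := h
  have key : ∀ R R' : CellRun O, R.col = R'.col → R.lo ≤ R'.hi + 1 → R'.lo ≤ R.hi + 1 →
      R.lo ≤ R'.lo ∧ R'.hi ≤ R.hi := by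
    intro R R' hc h₁ h₂
    have l₁ := R.lo_le_hi
    have l₂ := R'.lo_le_hi
    constructor
    · by_contra h
      exact R'.not_mem (R.lo - 1) (by omega) (by omega) (hc ▸ R.below)
    · by_contra h
      exact R'.not_mem (R.hi + 1) (by omega) (by omega) (hc ▸ R.above)
  have k₁ := key R R' hc h₁ h₂
  have k₂ := key R' R hc.symm h₂ h₁
  exact CellRun.ext hc (by omega) (by omega)

theorem isExtensor_rect_inter (Y : Type) [TopologicalSpace Y] [NormalSpace Y] {R R' : CellRun O}
    (h : (R.rect ∩ R'.rect).Nonempty) : IsExtensor Y (R.rect ∩ R'.rect) := by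
  simp only [rect, Icc_inter_Icc] at h ⊢
  exact isExtensor_Icc Y (nonempty_Icc.1 h)

theorem finite_of_finite (hO : {c : ℤ × ℤ | ¬ O c.1 c.2}.Finite) : Finite (CellRun O) := by
  have := hO.to_subtype
  let f : CellRun O → {c : ℤ × ℤ | ¬ O c.1 c.2} × {c : ℤ × ℤ | ¬ O c.1 c.2} := fun R =>
    (⟨(R.col, R.lo), R.not_mem _ le_rfl R.lo_le_hi⟩,
      ⟨(R.col, R.hi), R.not_mem _ R.lo_le_hi le_rfl⟩)
  refine Finite.of_injective f fun R R' h => ?_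
  simp only [f, Prod.mk.injEq, Subtype.mk.injEq] at h
  exact CellRun.ext h.1.1 h.1.2 h.2.2

/-- Every cell not satisfying `O` lies in a run. -/
theorem exists_gridCell_subset_rect (hO : {c : ℤ × ℤ | ¬ O c.1 c.2}.Finite) {i j : ℤ}
    (h : ¬ O i j) : ∃ R : CellRun O, gridCell i j ⊆ R.rect := by
  have hfin : {k : ℤ | ¬ O i k}.Finite :=
    hO.preimage (f := fun k => (i, k)) fun a _ b _ hab => by simpa using hab
  obtain ⟨u, hu⟩ := hfin.bddAbove
  obtain ⟨l, hl⟩ := hfin.bddBelow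
  have out_of_gt : ∀ k, u < k → O i k := fun k hk => by
    by_contra h
    exact absurd (hu h) (not_le.2 hk)
  have out_of_lt : ∀ k, k < l → O i k := fun k hk => by
    by_contra h
    exact absurd (hl h) (not_le.2 hk)
  obtain ⟨a, ⟨ha, haj⟩, ha'⟩ := Int.exists_greatest_of_bdd (P := fun k => O i k ∧ k < j)
    ⟨j, fun k hk => hk.2.le⟩ ⟨min (l - 1) (j - 1), out_of_lt _ (by omega), by omega⟩
  obtain ⟨b, ⟨hb, hbj⟩, hb'⟩ := Int.exists_least_of_bdd (P := fun k => O i k ∧ j < k)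
    ⟨j, fun k hk => hk.2.le⟩ ⟨max (u + 1) (j + 1), out_of_gt _ (by omega), by omega⟩
  refine ⟨⟨i, a + 1, b - 1, by omega, fun k hk hk' hOk => ?_, by simpa using ha,
    by simpa using hb⟩, Icc_subset_Icc ⟨le_rfl, ?_⟩ ⟨le_rfl, ?_⟩⟩
  · rcases lt_trichotomy k j with hkj | rfl | hkj
    · have := ha' k ⟨hOk, hkj⟩; omega
    · exact h hOk
    · have := hb' k ⟨hOk, hkj⟩; omega
  · simp only; exact_mod_cast haj
  · simp only; exact_mod_cast (by omega : j + 1 ≤ b - 1 + 1)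

/-- Every point of a run lies in one of its cells. -/
theorem exists_mem_gridCell {R : CellRun O} {z : ℝ × ℝ} (hz : z ∈ R.rect) :
    ∃ i j, ¬ O i j ∧ z ∈ gridCell i j := by
  obtain ⟨⟨a₁, a₂⟩, a₃, a₄⟩ := hz
  simp only at a₁ a₂ a₃ a₄
  have hl := R.lo_le_hi
  by_cases h : z.2 < R.hi + 1
  · refine ⟨R.col, ⌊z.2⌋, R.not_mem _ (Int.le_floor.2 a₂) ?_,
      mem_gridCell.2 ⟨⟨a₁, a₃⟩, Int.floor_le _, (Int.lt_floor_add_one _).le⟩⟩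
    exact Int.lt_add_one_iff.1 (Int.floor_lt.2 (by exact_mod_cast h))
  · exact ⟨R.col, R.hi, R.not_mem _ hl le_rfl,
      mem_gridCell.2 ⟨⟨a₁, a₃⟩, by linarith, a₄⟩⟩

/-- The contacts across the vertical grid line `k` at height at least `m` form a coboundary. -/
def Potential (O : ℤ → ℤ → Prop) (k m : ℤ) : Prop :=
  ∃ n : CellRun O → ℤ, ∀ R R' : CellRun O, R.Touch R' → R'.col = R.col + 1 →
    n R' - n R = if R'.col = k ∧ m ≤ max R.lo R'.lo then 1 else 0

theorem lt_or_lt_of_mem (R : CellRun O) {i j : ℤ} (h : O i j) (hc : R.col = i) :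
    R.hi < j ∨ j < R.lo := by
  by_contra! h'
  exact R.not_mem j h'.2 h'.1 (hc ▸ h)

/-- A ray emanating upward from a cell satisfying `O` can be moved across its column. -/
theorem potential_iff_of_mem {i j : ℤ} (h : O i j) :
    Potential O i (j + 1) ↔ Potential O (i + 1) (j + 1) := by
  let ind : CellRun O → ℤ := fun R => if R.col = i ∧ j < R.lo then 1 else 0
  have key : ∀ R R' : CellRun O, R.Touch R' → R'.col = R.col + 1 →
      (if R'.col = i ∧ j + 1 ≤ max R.lo R'.lo then (1 : ℤ) else 0) -
        (if R'.col = i + 1 ∧ j + 1 ≤ max R.lo R'.lo then 1 else 0) = ind R' - ind R := by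
    rintro R R' ⟨-, h₁, h₂⟩ hc
    have l := R.lo_le_hi
    have l' := R'.lo_le_hi
    have o := R.lt_or_lt_of_mem h
    have o' := R'.lt_or_lt_of_mem h
    simp only [ind]
    split_ifs <;> omega
  constructor
  · rintro ⟨n, hn⟩
    refine ⟨n - ind, fun R R' hT hc => ?_⟩
    have h₁ := hn R R' hT hc
    have h₂ := key R R' hT hc
    simp only [Pi.sub_apply]
    linarith
  · rintro ⟨n, hn⟩
    refine ⟨n + ind, fun R R' hT hc => ?_⟩
    have h₁ := hn R R' hT hc
    have h₂ := key R R' hT hc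
    simp only [Pi.add_apply]
    linarith

theorem potential_succ_iff_of_mem {i j : ℤ} (h : O i j) (h' : O i (j + 1)) :
    Potential O i (j + 1) ↔ Potential O i (j + 1 + 1) := by
  refine exists_congr fun n => forall₂_congr fun R R' => ?_
  refine forall₂_congr fun hT hc => ?_
  have : (R'.col = i ∧ j + 1 ≤ max R.lo R'.lo) ↔
      (R'.col = i ∧ j + 1 + 1 ≤ max R.lo R'.lo) := by
    obtain ⟨-, h₁, h₂⟩ := hT
    have l := R.lo_le_hi
    have l' := R'.lo_le_hi
    have o := R'.lt_or_lt_of_mem h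
    have o' := R'.lt_or_lt_of_mem h'
    omega
  rw [if_congr this rfl rfl]

theorem potential_of_outerCell {P : Set (ℤ × ℤ)} {N i j : ℤ} (h : OuterCell P N i j) :
    Potential (OuterCell P N) i (j + 1) := by
  have bound : ∀ R : CellRun (OuterCell P N), (-N ≤ R.col ∧ R.col ≤ N) ∧
      (-N ≤ R.lo ∧ R.lo ≤ N) := fun R => by
    have h := R.not_mem _ le_rfl R.lo_le_hi
    have h₁ : ¬ (N < |R.col| ∨ N < |R.lo|) := fun h' => h (.far h')
    push Not at h₁
    exact ⟨abs_le.1 h₁.1, abs_le.1 h₁.2⟩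
  induction h with
  | @far i j hij =>
    by_cases hlow : j < -N
    · refine ⟨fun R => if i ≤ R.col then 1 else 0, fun R R' _ hc => ?_⟩
      have := bound R
      dsimp only
      split_ifs <;> omega
    · refine ⟨0, fun R R' _ hc => ?_⟩
      have b := bound R
      have b' := bound R'
      rw [if_neg]
      · simp
      · rintro ⟨rfl, hm⟩
        rcases hij with hi | hj
        · rcases lt_abs.1 hi with hi | hi <;> omega
        · rcases lt_abs.1 hj with hj | hj <;> omega
  | @horizontal i i' j h hi hP ih =>
    rcases hi with rfl | rfl
    · exact (potential_iff_of_mem h).1 ih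
    · exact (potential_iff_of_mem (h.horizontal (Or.inr rfl) hP)).2 ih
  | @vertical i j j' h hj hP ih =>
    rcases hj with rfl | rfl
    · exact (potential_succ_iff_of_mem h (h.vertical (Or.inl rfl) hP)).1 ih
    · exact (potential_succ_iff_of_mem (h.vertical (Or.inr rfl) hP) h).2 ih

/-- Every edge of the contact graph of the runs of non-outer cells is cut by an integer function
that is constant across all other edges. -/
theorem exists_cut {P : Set (ℤ × ℤ)} {N : ℤ} (R R' : CellRun (OuterCell P N)) (hne : R ≠ R')
    (hT : R.Touch R') : ∃ n : CellRun (OuterCell P N) → ℤ, n R ≠ n R' ∧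
      ∀ Q Q', Q.Touch Q' → n Q ≠ n Q' → (Q = R ∧ Q' = R') ∨ (Q = R' ∧ Q' = R) := by
  wlog hc : R'.col = R.col + 1 generalizing R R'
  · have hcol : R.col ≠ R'.col := fun h => hne (hT.eq_of_col_eq h)
    obtain ⟨n, hn, hn'⟩ := this R' R hne.symm hT.symm (by have := hT.1; omega)
    exact ⟨n, hn.symm, fun Q Q' h h' => (hn' Q Q' h h').symm⟩
  obtain ⟨hT₀, hT₁, hT₂⟩ := hT
  have top : Potential (OuterCell P N) R'.col (min R.hi R'.hi + 2) := by
    rcases le_total R.hi R'.hi with h | h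
    · have := (potential_iff_of_mem R.above).1 (potential_of_outerCell R.above)
      rwa [min_eq_left h, hc, show R.hi + 2 = R.hi + 1 + 1 by ring]
    · have := potential_of_outerCell R'.above
      rwa [min_eq_right h, show R'.hi + 2 = R'.hi + 1 + 1 by ring]
  have bottom : Potential (OuterCell P N) R'.col (max R.lo R'.lo) := by
    rcases le_total R'.lo R.lo with h | h
    · have := (potential_iff_of_mem R.below).1 (potential_of_outerCell R.below)
      rwa [max_eq_left h, hc, show R.lo = R.lo - 1 + 1 by ring]
    · have := potential_of_outerCell R'.below
      rwa [max_eq_right h, show R'.lo = R'.lo - 1 + 1 by ring]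
  obtain ⟨t, ht⟩ := top
  obtain ⟨b, hb⟩ := bottom
  have l := R.lo_le_hi
  have l' := R'.lo_le_hi
  refine ⟨b - t, ?_, ?_⟩
  · have h₁ := hb R R' ⟨hT₀, hT₁, hT₂⟩ hc
    have h₂ := ht R R' ⟨hT₀, hT₁, hT₂⟩ hc
    rw [if_pos ⟨rfl, le_rfl⟩] at h₁
    rw [if_neg (by omega)] at h₂
    simp only [Pi.sub_apply]
    omega
  · have key : ∀ Q Q' : CellRun (OuterCell P N), Q.Touch Q' → Q'.col = Q.col + 1 →
        (b - t) Q ≠ (b - t) Q' → Q = R ∧ Q' = R' := by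
      intro Q Q' hQ hcQ hne
      have h₁ := hb Q Q' hQ hcQ
      have h₂ := ht Q Q' hQ hcQ
      simp only [Pi.sub_apply] at hne
      have hcol : Q'.col = R'.col ∧ max R.lo R'.lo ≤ max Q.lo Q'.lo ∧
          max Q.lo Q'.lo ≤ min R.hi R'.hi + 1 := by
        split_ifs at h₁ h₂ <;> omega
      obtain ⟨-, hQ₁, hQ₂⟩ := hQ
      have lQ := Q.lo_le_hi
      have lQ' := Q'.lo_le_hi
      exact ⟨Touch.eq_of_col_eq ⟨by omega, by omega, by omega⟩ (by omega),
        Touch.eq_of_col_eq ⟨by omega, by omega, by omega⟩ (by omega)⟩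
    intro Q Q' hQ hne
    have hcol : Q.col ≠ Q'.col := fun h => hne (by rw [hQ.eq_of_col_eq h])
    have hcases : Q'.col = Q.col + 1 ∨ Q.col = Q'.col + 1 := by have := hQ.1; omega
    rcases hcases with h | h
    · exact Or.inl (key Q Q' hQ h hne)
    · exact Or.inr (key Q' Q hQ.symm h hne.symm).symm

end CellRun

/-! ### From connected sets in the plane to contractions -/

/-- An extensor contracts in itself. -/
theorem IsExtensor.exists_contraction {E : Type*} [TopologicalSpace E] {Q : Set E}
    (h : IsExtensor (E × ℝ) Q) (hQ : IsClosed Q) {x₀ : E} (hx₀ : x₀ ∈ Q) :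
    ∃ G : E × ℝ → E, Continuous G ∧ (∀ y, G y ∈ Q) ∧ (∀ x ∈ Q, G (x, 0) = x) ∧
      ∀ x ∈ Q, G (x, 1) = x₀ := by
  have c₀ : IsClosed (Q ×ˢ ({0} : Set ℝ)) := hQ.prod isClosed_singleton
  have c₁ : IsClosed (Q ×ˢ ({1} : Set ℝ)) := hQ.prod isClosed_singleton
  let f : E × ℝ → E := fun y => if y.2 = 0 then y.1 else x₀
  have f₀ : EqOn f Prod.fst (Q ×ˢ ({0} : Set ℝ)) := fun y hy => if_pos hy.2
  have f₁ : EqOn f (fun _ => x₀) (Q ×ˢ ({1} : Set ℝ)) := fun y hy =>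
    if_neg (by rw [show y.2 = 1 from hy.2]; exact one_ne_zero)
  obtain ⟨G, hG, hGQ, hGf⟩ := h _ f (c₀.union c₁)
    ((continuous_fst.continuousOn.congr f₀).union_of_isClosed
      (continuousOn_const.congr f₁) c₀ c₁) (by
        rintro y (hy | hy)
        · rw [f₀ hy]; exact hy.1
        · rw [f₁ hy]; exact hx₀)
  refine ⟨G, hG, hGQ, fun x hx => ?_, fun x hx => ?_⟩
  · have hy : (x, (0 : ℝ)) ∈ Q ×ˢ ({0} : Set ℝ) := ⟨hx, rfl⟩
    exact (hGf (Or.inl hy)).trans (f₀ hy)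
  · have hy : (x, (1 : ℝ)) ∈ Q ×ˢ ({1} : Set ℝ) := ⟨hx, rfl⟩
    exact (hGf (Or.inr hy)).trans (f₁ hy)

/-- A bounded connected planar set `K` lies in a closed extensor `Q`. The set `Q` lies in a compact
set `L` that is open away from the unit neighbourhood `P` of `K`: it arises by filling holes. -/
theorem exists_isExtensor_superset (Y : Type) [MetricSpace Y] {K : Set (ℝ × ℝ)}
    (hK : IsPreconnected K) (hne : K.Nonempty) (hb : Bornology.IsBounded K) :
    ∃ Q L P : Set (ℝ × ℝ), K ⊆ Q ∧ Q ⊆ L ∧ IsClosed Q ∧ IsExtensor Y Q ∧ IsCompact L ∧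
      (∀ z ∈ P, ∃ x ∈ K, dist z x ≤ 1) ∧ L \ P ⊆ interior L := by
  obtain ⟨C, hC⟩ := hb.exists_norm_le
  set P₀ : Set (ℤ × ℤ) := {c | (gridCell c.1 c.2 ∩ K).Nonempty} with hP₀
  obtain ⟨N, hN⟩ : ∃ N : ℤ, ∀ c ∈ P₀, |c.1| ≤ N ∧ |c.2| ≤ N := by
    refine ⟨⌈C⌉ + 1, ?_⟩
    rintro ⟨i, j⟩ ⟨z, hz, hzK⟩
    obtain ⟨⟨a₁, a₂⟩, a₃, a₄⟩ := mem_gridCell.1 hz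
    have h₁ := abs_le.1 (((norm_fst_le z).trans (hC z hzK)).trans (Int.le_ceil C))
    have h₂ := abs_le.1 (((norm_snd_le z).trans (hC z hzK)).trans (Int.le_ceil C))
    simp only at a₁ a₂ a₃ a₄ ⊢
    have key : ∀ (k : ℤ) (t : ℝ), (k : ℝ) ≤ t → t ≤ k + 1 → -(⌈C⌉ : ℝ) ≤ t ∧ t ≤ ⌈C⌉ →
        |k| ≤ ⌈C⌉ + 1 := fun k t hk hk' ht => abs_le.2
      ⟨by have : (-(⌈C⌉ : ℝ)) ≤ k + 1 := ht.1.trans hk'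
          have : -⌈C⌉ ≤ k + 1 := by exact_mod_cast this
          omega,
        by have : (k : ℝ) ≤ ⌈C⌉ := hk.trans ht.2
           have : k ≤ ⌈C⌉ := by exact_mod_cast this
           omega⟩
    exact ⟨key i _ a₁ a₂ h₁, key j _ a₃ a₄ h₂⟩
  have hfin := finite_not_outerCell P₀ N
  have := CellRun.finite_of_finite hfin
  have hcover : K ⊆ ⋃ R : CellRun (OuterCell P₀ N), R.rect := fun z hz => by
    have hc : (⌊z.1⌋, ⌊z.2⌋) ∈ P₀ := ⟨z, mem_gridCell_floor z, hz⟩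
    obtain ⟨R, hR⟩ := CellRun.exists_gridCell_subset_rect hfin (not_outerCell_of_mem hN hc)
    exact mem_iUnion.2 ⟨R, hR (mem_gridCell_floor z)⟩
  obtain ⟨s, hKs, hs⟩ := exists_isExtensor_biUnion (Y := Y)
    (R := fun R : CellRun (OuterCell P₀ N) => R.rect) (fun R => isClosed_Icc)
    (fun R R' => CellRun.isExtensor_rect_inter Y)
    (fun R R' hne hRR' => by
      obtain ⟨n, hn, hn'⟩ := CellRun.exists_cut R R' hne (CellRun.touch_of_nonempty hRR')
      exact ⟨n, hn, fun Q Q' h => hn' Q Q' (CellRun.touch_of_nonempty h)⟩) hK hne hcover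
  refine ⟨_, ⋃ c ∈ {c : ℤ × ℤ | ¬ OuterCell P₀ N c.1 c.2}, gridCell c.1 c.2,
    ⋃ c ∈ P₀, gridCell c.1 c.2, hKs, ?_, (toFinite s).isClosed_biUnion fun R _ => isClosed_Icc,
    hs, hfin.isCompact_biUnion fun c _ => isCompact_Icc, ?_, ?_⟩
  · refine iUnion₂_subset fun R _ z hz => ?_
    obtain ⟨i, j, hij, hz'⟩ := CellRun.exists_mem_gridCell hz
    exact mem_biUnion (x := (i, j)) hij hz'
  · intro z hz
    simp only [mem_iUnion, exists_prop] at hz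
    obtain ⟨c, ⟨x, hx, hxK⟩, hz⟩ := hz
    obtain ⟨⟨a₁, a₂⟩, a₃, a₄⟩ := mem_gridCell.1 hz
    obtain ⟨⟨b₁, b₂⟩, b₃, b₄⟩ := mem_gridCell.1 hx
    refine ⟨x, hxK, ?_⟩
    rw [Prod.dist_eq, max_le_iff, Real.dist_eq, Real.dist_eq, abs_le, abs_le]
    exact ⟨⟨by linarith, by linarith⟩, by linarith, by linarith⟩
  · rintro z ⟨hz, hzP⟩
    simp only [mem_iUnion, exists_prop, not_exists, not_and] at hz hzP
    obtain ⟨c, hc, hzc⟩ := hz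
    rw [mem_interior]
    refine ⟨Ioo ((⌈z.1⌉ : ℝ) - 1) (⌊z.1⌋ + 1) ×ˢ Ioo ((⌈z.2⌉ : ℝ) - 1) (⌊z.2⌋ + 1), ?_,
      isOpen_Ioo.prod isOpen_Ioo, ?_⟩
    · intro w hw
      have key : ∀ t u : ℝ, u ∈ Ioo ((⌈t⌉ : ℝ) - 1) (⌊t⌋ + 1) →
          (⌊u⌋ : ℝ) ≤ t ∧ t ≤ ⌊u⌋ + 1 := by
        rintro t u ⟨hu, hu'⟩
        have h₁ : ⌊u⌋ ≤ ⌊t⌋ := Int.lt_add_one_iff.1 (Int.floor_lt.2 (by exact_mod_cast hu'))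
        have h₂ : ⌈t⌉ - 1 ≤ ⌊u⌋ := Int.le_floor.2 (by exact_mod_cast hu.le)
        have h₃ : ⌈t⌉ ≤ ⌊u⌋ + 1 := by omega
        exact ⟨(Int.cast_le.2 h₁).trans (Int.floor_le t),
          (Int.le_ceil t).trans (by exact_mod_cast h₃)⟩
      have hzw : z ∈ gridCell ⌊w.1⌋ ⌊w.2⌋ := mem_gridCell.2 ⟨key _ _ hw.1, key _ _ hw.2⟩
      exact mem_biUnion (x := (⌊w.1⌋, ⌊w.2⌋))
        (fun h => hc (h.of_mem_gridCell hzP hzw hzc)) (mem_gridCell_floor w)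
    · exact ⟨⟨by linarith [Int.ceil_lt_add_one z.1], Int.lt_floor_add_one _⟩,
        by linarith [Int.ceil_lt_add_one z.2], Int.lt_floor_add_one _⟩

/-! ### Topological spheres -/

/-- Stereographic projection of a topological 2-sphere from a point `b`. -/
theorem exists_openPartialHomeomorph_plane {Z : Type*} [TopologicalSpace Z]
    (f : Z ≃ₜ sphere (0 : EuclideanSpace ℝ (Fin 3)) 1) (b : Z) :
    ∃ e : OpenPartialHomeomorph Z (ℝ × ℝ), e.source = {b}ᶜ ∧ e.target = univ := by
  have : Fact (Module.finrank ℝ (EuclideanSpace ℝ (Fin 3)) = 2 + 1) :=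
    ⟨finrank_euclideanSpace_fin⟩
  let p : EuclideanSpace ℝ (Fin 2) ≃ₜ ℝ × ℝ :=
    (EuclideanSpace.equiv (Fin 2) ℝ).toHomeomorph.trans Homeomorph.finTwoArrow
  refine ⟨(f.toOpenPartialHomeomorph.trans (stereographic' 2 (f b))).trans
    p.toOpenPartialHomeomorph, ?_, ?_⟩
  · ext x
    simp
  · simp

/-- In a topological 2-sphere, if every point outside `V` can be joined to `b` by a connected set
avoiding the open set `V₀`, then every connected set `K` with closure in `V₀` contracts
inside `V`. -/
theorem exists_contraction_of_sphere {Z : Type*} [TopologicalSpace Z]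
    (f : Z ≃ₜ sphere (0 : EuclideanSpace ℝ (Fin 3)) 1) {K V₀ V : Set Z} {b : Z}
    (hK : IsConnected K) (hV₀ : IsOpen V₀) (hKV₀ : closure K ⊆ V₀) (hb : b ∉ V₀)
    (hV : ∀ x ∉ V, ∃ E, IsPreconnected E ∧ E ⊆ V₀ᶜ ∧ x ∈ E ∧ b ∈ E) :
    ∃ H : Z × ℝ → Z, ContinuousOn H (K ×ˢ univ) ∧ (∀ x ∈ K, H (x, 0) = x) ∧
      (∃ z, ∀ x ∈ K, H (x, 1) = z) ∧ ∀ x ∈ K, ∀ t, H (x, t) ∈ V := by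
  have : CompactSpace Z := f.symm.compactSpace
  have : T2Space Z := f.isEmbedding.t2Space
  obtain ⟨e₀, hs₀, ht₀⟩ := exists_openPartialHomeomorph_plane f b
  have hsub₀ : V₀ ⊆ e₀.source := fun x hx => by
    rw [hs₀]
    rintro rfl
    exact hb hx
  have hKc : IsCompact (e₀ '' closure K) :=
    isClosed_closure.isCompact.image_of_continuousOn (e₀.continuousOn.mono (hKV₀.trans hsub₀))
  obtain ⟨δ, hδ, hδV⟩ := hKc.exists_thickening_subset_open
    (e₀.isOpen_image_of_subset_source hV₀ hsub₀) (image_mono hKV₀)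
  -- rescale the plane so that the unit neighbourhood of the image of `K` lies in that of `V₀`
  obtain ⟨e, hs, ht, he⟩ : ∃ e : OpenPartialHomeomorph Z (ℝ × ℝ), e.source = {b}ᶜ ∧
      e.target = univ ∧ ∀ x ∈ K, ∀ z, dist z (e x) ≤ 1 → e.symm z ∈ V₀ := by
    have hc : (2 / δ) ≠ 0 := by positivity
    refine ⟨e₀.trans (Homeomorph.smulOfNeZero (2 / δ) hc).toOpenPartialHomeomorph,
      by simp [hs₀], by simp [ht₀], fun x hx z hz => ?_⟩
    have hz' : (2 / δ)⁻¹ • z ∈ thickening δ (e₀ '' closure K) := by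
      refine mem_thickening_iff.2 ⟨e₀ x, mem_image_of_mem _ (subset_closure hx), ?_⟩
      have hx' : e₀ x = (2 / δ)⁻¹ • ((2 / δ) • e₀ x) := by rw [inv_smul_smul₀ hc]
      have hz : dist z ((2 / δ) • e₀ x) ≤ 1 := hz
      rw [hx', dist_smul₀, norm_inv, Real.norm_of_nonneg (by positivity), inv_div]
      calc δ / 2 * dist z ((2 / δ) • e₀ x) ≤ δ / 2 * 1 := by gcongr
        _ < δ := by linarith
    obtain ⟨y, hy, hyz⟩ := hδV hz'
    change e₀.symm ((2 / δ)⁻¹ • z) ∈ V₀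
    rw [← hyz, e₀.left_inv (hsub₀ hy)]
    exact hy
  have hsub : V₀ ⊆ e.source := by rw [hs, ← hs₀]; exact hsub₀
  have hKs : closure K ⊆ e.source := hKV₀.trans hsub
  have hKs' : K ⊆ e.source := subset_closure.trans hKs
  have hmem : ∀ z, z ∈ e.target := fun z => by rw [ht]; exact mem_univ z
  have hsymm : Continuous e.symm := by
    rw [← continuousOn_univ, ← ht]
    exact e.continuousOn_symm
  obtain ⟨Q, L, P, hKQ, hQL, hQ, hext, hL, hP, hLP⟩ := exists_isExtensor_superset ((ℝ × ℝ) × ℝ)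
    (hK.isPreconnected.image e (e.continuousOn.mono hKs')) (hK.nonempty.image e)
    ((isClosed_closure.isCompact.image_of_continuousOn (e.continuousOn.mono hKs)).isBounded.subset
      (image_mono subset_closure))
  have hPV₀ : ∀ z ∈ P, e.symm z ∈ V₀ := fun z hz => by
    obtain ⟨_, ⟨x, hx, rfl⟩, hzx⟩ := hP z hz
    exact he x hx z hzx
  have hQV : ∀ z ∈ Q, e.symm z ∈ V := by
    intro z hz
    by_contra hzV
    obtain ⟨E, hE, hEV₀, hzE, hbE⟩ := hV _ hzV
    have hopen : IsOpen (e.source ∩ e ⁻¹' interior L) :=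
      e.isOpen_inter_preimage isOpen_interior
    have hinter : ∀ l ∈ L, e.symm l ∈ E → e.symm l ∈ e.source ∩ e ⁻¹' interior L := by
      intro l hl hlE
      refine ⟨e.map_target (hmem l), ?_⟩
      rw [mem_preimage, e.right_inv (hmem l)]
      exact hLP ⟨hl, fun hlP => hEV₀ hlE (hPV₀ l hlP)⟩
    have hbL : b ∈ (e.symm '' L)ᶜ := by
      rintro ⟨l, -, hl⟩
      have := e.map_target (hmem l)
      rw [hs, hl] at this
      exact this rfl
    obtain ⟨y, -, hy, hy'⟩ := hE _ _ (hL.image hsymm).isClosed.isOpen_compl hopen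
      (fun y hy => by
        by_cases hyL : y ∈ e.symm '' L
        · obtain ⟨l, hl, rfl⟩ := hyL
          exact Or.inr (hinter l hl hy)
        · exact Or.inl hyL)
      ⟨b, hbE, hbL⟩ ⟨_, hzE, hinter z (hQL hz) hzE⟩
    exact hy ⟨e y, interior_subset hy'.2, e.left_inv hy'.1⟩
  obtain ⟨x₀, hx₀⟩ := hK.nonempty
  obtain ⟨G, hG, hGQ, hG₀, hG₁⟩ := hext.exists_contraction hQ (hKQ (mem_image_of_mem e hx₀))
  refine ⟨fun y => e.symm (G (e y.1, y.2)), ?_, fun x hx => ?_, ⟨e.symm (e x₀), fun x hx => ?_⟩,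
    fun x _ t => hQV _ (hGQ _)⟩
  · refine (hsymm.comp hG).comp_continuousOn (ContinuousOn.prodMk ?_ continuousOn_snd)
    exact (e.continuousOn.mono hKs').comp continuousOn_fst fun y hy => hy.1
  · simp only [hG₀ _ (hKQ (mem_image_of_mem e hx)), e.left_inv (hKs' hx)]
  · simp only [hG₁ _ (hKQ (mem_image_of_mem e hx))]

/-- Some point is at distance at least a quarter of the diameter from a given point. -/
theorem exists_diam_div_four_le_dist {Z : Type*} [PseudoMetricSpace Z] (a : Z)
    (h : 0 < diam (univ : Set Z)) : ∃ b, diam (univ : Set Z) / 4 ≤ dist b a := by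
  by_contra! hb
  have : diam (univ : Set Z) ≤ 2 * (diam (univ : Set Z) / 4) :=
    (diam_mono (fun x _ => mem_closedBall.2 (hb x).le) isBounded_closedBall).trans
      (diam_closedBall (by positivity))
  linarith

/-- If a metric space homeomorphic to the 2-sphere is LLC, then it is linearly locally
contractible (with a constant depending on `Z`, not just the LLC constant). -/
theorem stmt_12 (Z : Type*) [MetricSpace Z]
    (hZ : Nonempty (Z ≃ₜ ↥(Metric.sphere (0 : EuclideanSpace ℝ (Fin 3)) 1)))
    (lam : ℝ) (hlam : 1 ≤ lam) (h : IsLLC Z lam) :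
    ∃ lam' : ℝ, 1 ≤ lam' ∧ LinLocContractible Z lam' := by
  obtain ⟨f⟩ := hZ
  obtain ⟨h₁, h₂⟩ := h
  have hpos : 0 < lam := by linarith
  have hsq : 1 ≤ lam ^ 2 := one_le_pow₀ hlam
  refine ⟨8 * lam ^ 2, by linarith, fun a r hr hrD => ?_⟩
  rw [le_div_iff₀ (by positivity)] at hrD
  obtain ⟨b, hb⟩ := exists_diam_div_four_le_dist a
    ((by positivity : 0 < r * (8 * lam ^ 2)).trans_le hrD)
  have hbV : b ∉ ball a (2 * lam ^ 2 * r) := by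
    rw [mem_ball, not_lt]
    linarith
  have hle : 2 * lam * r ≤ 2 * lam ^ 2 * r := by gcongr; nlinarith
  have ha : a ∈ ball a r := mem_ball_self hr
  -- a connected set between `ball a r` and `ball a (lam * r)`
  let K : Set Z := ⋃₀ {E | IsConnected E ∧ E ⊆ ball a (lam * r) ∧ a ∈ E}
  have hballK : ball a r ⊆ K := fun x hx => by
    obtain ⟨E, hE, hEs, hxE, haE⟩ := h₁ a r x hx a ha
    exact ⟨E, ⟨hE.2.1, hEs, haE⟩, hxE⟩
  have hK : IsConnected K :=
    ⟨⟨a, hballK ha⟩, isPreconnected_sUnion a _ (fun E hE => hE.2.2) fun E hE => hE.1.isPreconnected⟩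
  have hclosure : closure K ⊆ ball a (2 * lam * r) := by
    refine (closure_minimal (sUnion_subset fun E hE => hE.2.1.trans ball_subset_closedBall)
      isClosed_closedBall).trans (closedBall_subset_ball ?_)
    nlinarith [mul_pos hpos hr]
  obtain ⟨H, hH, hH₀, ⟨z, hH₁⟩, hHV⟩ := exists_contraction_of_sphere f
    (V := ball a (2 * lam ^ 2 * r)) hK isOpen_ball hclosure
    (fun hb' => hbV (ball_subset_ball hle hb')) fun x hx => by
      obtain ⟨E, hE, hEs, hxE, hbE⟩ := h₂ a (2 * lam ^ 2 * r) x hx b hbV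
      rw [show 2 * lam ^ 2 * r / lam = 2 * lam * r by field_simp] at hEs
      exact ⟨E, hE.2.1.isPreconnected, hEs, hxE, hbE⟩
  refine ⟨H, hH.mono (prod_mono hballK (subset_univ _)), fun x hx => hH₀ x (hballK hx),
    ⟨z, fun x hx => hH₁ x (hballK hx)⟩, fun x hx t _ => ball_subset_ball ?_ (hHV x (hballK hx) t)⟩
  gcongr
  norm_num
end

section
/- Let Z be a metric space homeomorphic to the 2-sphere. If Z is λ-LLC, then every continuous loop φ: S¹ → Z whose image lies in a ball B(p,R) is null-homotopic in B(p,λR). -/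
/-- `f₀` can be modified off `S` to a continuous map whose values avoid `U`. -/
def Avoidable {P E : Type*} [TopologicalSpace P] [TopologicalSpace E] (f₀ : C(P, E)) (S : Set P)
    (U : Set E) : Prop :=
  ∃ f : C(P, E), Set.EqOn f f₀ S ∧ ∀ x, f x ∉ U

namespace Avoidable

variable {P E : Type*} [TopologicalSpace P]

theorem mono [TopologicalSpace E] {f₀ : C(P, E)} {S : Set P} {U V : Set E}
    (h : Avoidable f₀ S U) (hVU : V ⊆ U) : Avoidable f₀ S V := by
  obtain ⟨f, hf, hU⟩ := h
  exact ⟨f, hf, fun x hx => hU x (hVU hx)⟩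

theorem notMem [TopologicalSpace E] {f₀ : C(P, E)} {S : Set P} {U : Set E}
    (h : Avoidable f₀ S U) {x : P} (hx : x ∈ S) : f₀ x ∉ U := by
  obtain ⟨f, hf, hU⟩ := h
  exact hf hx ▸ hU x

/-- Radial projection from a point `w` of a convex body `B` pushes a map avoiding `w` off the
interior of `B`. -/
theorem union_interior [NormedAddCommGroup E] [NormedSpace ℝ E] {f₀ : C(P, E)} {S : Set P}
    {U : Set E} (h : Avoidable f₀ S U) {B : Set E} (hconv : Convex ℝ B)
    (hbdd : Bornology.IsBounded B) {w : E} (hwB : w ∈ interior B) (hwU : w ∈ U)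
    (hUB : ∀ y ∈ frontier B, y ∉ U) (hS : ∀ x ∈ S, f₀ x ∉ interior B) :
    Avoidable f₀ S (U ∪ interior B) := by
  obtain ⟨f, hf, hU⟩ := h
  set τ : E ≃ₜ E := Homeomorph.addLeft w
  set s : Set E := τ ⁻¹' B
  have hτ : ∀ v, τ v = w + v := fun v => rfl
  have hsconv : Convex ℝ s := hconv.translate_preimage_right w
  have hsint : interior s = τ ⁻¹' interior B := (τ.preimage_interior B).symm
  have hsfr : frontier s = τ ⁻¹' frontier B := (τ.preimage_frontier B).symm
  have hs0 : s ∈ nhds (0 : E) := by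
    rw [mem_nhds_iff]
    exact ⟨interior s, interior_subset, isOpen_interior, by rw [hsint]; simpa [hτ] using hwB⟩
  have hsb : Bornology.IsBounded s := by
    have : s = (fun y => -w + y) '' B := by
      ext v
      simp [s, hτ]
    rw [this]
    exact hbdd.vadd (-w)
  have hcont := continuous_gauge hsconv hs0
  have habs : Absorbent ℝ s := absorbent_nhds_zero hs0
  have hpos : ∀ x, 0 < gauge s (f x - w) := fun x => by
    rw [gauge_pos habs ((NormedSpace.isVonNBounded_iff ℝ).2 hsb), sub_ne_zero]
    rintro hx
    exact hU x (hx ▸ hwU)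
  have hm : ∀ x, 0 < min 1 (gauge s (f x - w)) := fun x => lt_min one_pos (hpos x)
  let f' : C(P, E) := ⟨fun x => w + (min 1 (gauge s (f x - w)))⁻¹ • (f x - w), by
    have : Continuous fun x => (min 1 (gauge s (f x - w)))⁻¹ :=
      (continuous_const.min (hcont.comp (by fun_prop))).inv₀ fun x => (hm x).ne'
    fun_prop⟩
  have hid : ∀ x, f x ∉ interior B → f' x = f x := fun x hx => by
    have : 1 ≤ gauge s (f x - w) := by
      by_contra! hlt
      rw [gauge_lt_one_iff_mem_interior hsconv hs0, hsint] at hlt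
      exact hx (by simpa [hτ] using hlt)
    simp [f', min_eq_left this]
  have hfr : ∀ x, f x ∈ interior B → f' x ∈ frontier B := fun x hx => by
    have hlt : gauge s (f x - w) < 1 := by
      rw [gauge_lt_one_iff_mem_interior hsconv hs0, hsint]
      simpa [hτ] using hx
    have : (gauge s (f x - w))⁻¹ • (f x - w) ∈ frontier s := by
      rw [← gauge_eq_one_iff_mem_frontier hsconv hs0,
        gauge_smul_of_nonneg (inv_nonneg.2 (hpos x).le), smul_eq_mul,
        inv_mul_cancel₀ (hpos x).ne']
    rw [hsfr] at this
    have hmem : w + (gauge s (f x - w))⁻¹ • (f x - w) ∈ frontier B := this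
    simpa only [f', ContinuousMap.coe_mk, min_eq_right hlt.le] using hmem
  refine ⟨f', fun x hx => ?_, fun x => ?_⟩
  · have := hS x hx
    rw [← hf hx] at this
    rw [hid x this, hf hx]
  · by_cases hx : f x ∈ interior B
    · rintro (h | h)
      · exact hUB _ (hfr x hx) h
      · exact (hfr x hx).2 h
    · rw [hid x hx]
      rintro (h | h)
      exacts [hU x h, hx h]

/-- If a map meets the open set `O` only along an open segment crossing it, then it can be cut
open along that segment, by lifting the position on the segment from the circle to the line. -/
theorem union_of_subset_segment [SimplyConnectedSpace P] [LocallyPathConnectedSpace P]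
    [NormedAddCommGroup E] [NormedSpace ℝ E] {f₀ : C(P, E)} {S : Set P} (hSc : IsConnected S)
    {U O : Set E} (h : Avoidable f₀ S U) (hO : IsOpen O) {a d : E}
    {ℓ : E →L[ℝ] ℝ} (hℓ : ℓ d = 1)
    (hOU : ∀ y ∈ O, y ∉ U → ∃ t ∈ Set.Ioo (0 : ℝ) 1, y = a + t • d)
    (hseg : ∀ t ∈ Set.Ioo (0 : ℝ) 1, a + t • d ∈ O) (ha : a ∉ U ∪ O) (had : a + d ∉ U ∪ O)
    (hS : ∀ x ∈ S, f₀ x ∉ O) : Avoidable f₀ S (U ∪ O) := by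
  classical
  obtain ⟨f, hf, hU⟩ := h
  have hS' : ∀ x ∈ S, f x ∉ O := fun x hx => hf hx ▸ hS x hx
  have hfO : ∀ x, f x ∈ O → ∃ t ∈ Set.Ioo (0 : ℝ) 1, f x = a + t • d :=
    fun x hx => hOU _ hx (hU x)
  let T : Set E := (fun t : ℝ => a + t • d) '' Set.Icc 0 1
  have hT : IsClosed T := (isCompact_Icc.image (by fun_prop)).isClosed
  let u : P → AddCircle (1 : ℝ) := fun x => if f x ∈ O then ((ℓ (f x - a) : ℝ) : AddCircle (1 : ℝ))
    else 0
  have huO : ∀ x, f x ∉ O → u x = 0 := fun x hx => if_neg hx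
  have huT : ∀ x, f x ∈ T → u x = ((ℓ (f x - a) : ℝ) : AddCircle (1 : ℝ)) := by
    intro x hx
    by_cases hxO : f x ∈ O
    · exact if_pos hxO
    rw [huO x hxO]
    obtain ⟨t, ht, hxt⟩ := hx
    have hl : ℓ (f x - a) = t := by rw [← hxt]; simp [hℓ]
    rw [hl]
    rcases ht.1.eq_or_lt with h0 | h0
    · simp [← h0]
    rcases ht.2.eq_or_lt with h1 | h1
    · rw [h1, AddCircle.coe_period]
    · exact absurd (hxt ▸ hseg t ⟨h0, h1⟩) hxO
  have hu : Continuous u := by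
    rw [← continuousOn_univ]
    have hcov : Set.univ = f ⁻¹' Oᶜ ∪ f ⁻¹' T := by
      symm
      rw [Set.eq_univ_iff_forall]
      intro x
      by_cases hx : f x ∈ O
      · obtain ⟨t, ht, hxt⟩ := hfO x hx
        exact Or.inr ⟨t, Set.Ioo_subset_Icc_self ht, hxt.symm⟩
      · exact Or.inl hx
    rw [hcov]
    refine ContinuousOn.union_of_isClosed ?_ ?_ (hO.isClosed_compl.preimage f.continuous)
      (hT.preimage f.continuous)
    · exact (continuousOn_const (c := (0 : AddCircle (1 : ℝ)))).congr fun x hx => huO x hx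
    · have : Continuous fun x => ((ℓ (f x - a) : ℝ) : AddCircle (1 : ℝ)) :=
        (AddCircle.continuous_mk' (1 : ℝ)).comp (by fun_prop)
      exact this.continuousOn.congr fun x hx => huT x hx
  obtain ⟨x₀, hx₀⟩ := hSc.nonempty
  obtain ⟨F, ⟨hF₀, hF⟩, -⟩ := (AddCircle.isCoveringMap_coe (1 : ℝ)).existsUnique_continuousMap_lifts
    ⟨u, hu⟩ x₀ 0 (by simp [huO x₀ (hS' x₀ hx₀)])
  have hFu : ∀ x, ((F x : ℝ) : AddCircle (1 : ℝ)) = u x := fun x => congrFun hF x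
  have hFint : ∀ x, f x ∉ O → ∃ n : ℤ, F x = n := fun x hx => by
    have := hFu x
    rw [huO x hx, AddCircle.coe_eq_zero_iff] at this
    obtain ⟨n, hn⟩ := this
    exact ⟨n, by simpa using hn.symm⟩
  have hFpos : ∀ x, f x ∈ O → ∃ t ∈ Set.Ioo (0 : ℝ) 1, f x = a + t • d ∧ ∃ n : ℤ, F x = t + n := by
    intro x hx
    obtain ⟨t, ht, hxt⟩ := hfO x hx
    refine ⟨t, ht, hxt, ?_⟩
    have h1 := hFu x
    have hl : ℓ (f x - a) = t := by rw [hxt]; simp [hℓ]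
    rw [show u x = _ from if_pos hx, hl, ← sub_eq_zero, ← AddCircle.coe_sub,
      AddCircle.coe_eq_zero_iff] at h1
    obtain ⟨n, hn⟩ := h1
    refine ⟨n, ?_⟩
    rw [zsmul_eq_mul, mul_one] at hn
    linarith
  have hFS : ∀ x ∈ S, F x = 0 := by
    intro x hx
    have hpre : IsPreconnected (F '' S) := hSc.isPreconnected.image F F.continuous.continuousOn
    by_contra hne
    have hord := hpre.ordConnected
    obtain ⟨n, hn⟩ := hFint x (hS' x hx)
    have hn0 : n ≠ 0 := by rintro rfl; exact hne (by simpa using hn)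
    have h0 : (0 : ℝ) ∈ F '' S := ⟨x₀, hx₀, hF₀⟩
    have hnm : (n : ℝ) ∈ F '' S := ⟨x, hx, hn⟩
    have key : ∀ r : ℝ, r ∈ F '' S → ∃ m : ℤ, r = m := by
      rintro _ ⟨y, hy, rfl⟩
      exact hFint y (hS' y hy)
    rcases lt_or_gt_of_ne hn0 with hneg | hp
    · have : (n : ℝ) ≤ -1 := by exact_mod_cast Int.le_sub_one_of_lt hneg
      obtain ⟨m, hm⟩ := key _ (hord.out hnm h0 (show (-1 / 2 : ℝ) ∈ _ from
        ⟨by linarith, by norm_num⟩))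
      have : (2 * m : ℝ) = -1 := by linarith
      have : 2 * m = -1 := by exact_mod_cast this
      omega
    · have : (1 : ℝ) ≤ n := by exact_mod_cast hp
      obtain ⟨m, hm⟩ := key _ (hord.out h0 hnm (show (1 / 2 : ℝ) ∈ _ from
        ⟨by norm_num, by linarith⟩))
      have : (2 * m : ℝ) = 1 := by linarith
      have : 2 * m = 1 := by exact_mod_cast this
      omega
  let f' : P → E := fun x => if F x = 0 then f x else if 0 < F x then a else a + d
  have hloc : ∀ x, |F x| < 1 → f' x = f x - F x • d := by
    intro x hx
    rw [abs_lt] at hx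
    by_cases h0 : F x = 0
    · simp [f', h0]
    have hxO : f x ∈ O := by
      by_contra hxO
      obtain ⟨n, hn⟩ := hFint x hxO
      rw [hn] at hx h0
      have h1 : -1 < n := by exact_mod_cast hx.1
      have h2 : n < 1 := by exact_mod_cast hx.2
      exact h0 (by rw [show n = 0 by omega]; simp)
    obtain ⟨t, ht, hxt, n, hn⟩ := hFpos x hxO
    have h1 : (-2 : ℝ) < n := by linarith [ht.2, hx.1]
    have h2 : (n : ℝ) < 1 := by linarith [ht.1, hx.2]
    have h1 : -2 < n := by exact_mod_cast h1
    have h2 : n < 1 := by exact_mod_cast h2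
    obtain rfl | rfl : n = 0 ∨ n = -1 := by omega
    · have : 0 < F x := by rw [hn]; simpa using ht.1
      simp only [f', h0, this, if_true, if_false]
      rw [hxt, hn]
      simp
    · have : ¬ 0 < F x := by rw [hn]; push_cast; linarith [ht.2]
      simp only [f', h0, this, if_false]
      rw [hxt, hn]
      push_cast
      module
  have hf' : Continuous f' := by
    rw [continuous_iff_continuousAt]
    intro x
    rcases lt_trichotomy (F x) 0 with hx | hx | hx
    · refine (continuousAt_const (y := a + d)).congr ?_
      filter_upwards [F.continuous.continuousAt.eventually_lt_const hx] with y hy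
      simp [f', hy.ne, hy.not_gt]
    · have : ContinuousAt (fun y => f y - F y • d) x := by fun_prop
      refine this.congr ?_
      have h1 : ∀ᶠ y in nhds x, |F y| < 1 :=
        (F.continuous.abs.continuousAt).eventually_lt_const (by simp [hx])
      filter_upwards [h1] with y hy using (hloc y hy).symm
    · refine (continuousAt_const (y := a)).congr ?_
      filter_upwards [F.continuous.continuousAt.eventually_const_lt hx] with y hy
      simp [f', hy.ne', hy]
  refine ⟨⟨f', hf'⟩, fun x hx => ?_, fun x => ?_⟩
  · simp [f', hFS x hx, hf hx]
  · show f' x ∉ U ∪ O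
    by_cases h0 : F x = 0
    · have hxO : f x ∉ O := by
        intro hxO
        obtain ⟨t, ht, -, n, hn⟩ := hFpos x hxO
        rw [h0] at hn
        have h1 : (-1 : ℝ) < n := by linarith [ht.2]
        have h2 : (n : ℝ) < 0 := by linarith [ht.1]
        have h1 : -1 < n := by exact_mod_cast h1
        have h2 : n < 0 := by exact_mod_cast h2
        omega
      simp only [f', h0, if_true]
      rintro (h | h)
      exacts [hU x h, hxO h]
    · by_cases hp : 0 < F x
      · simpa only [f', h0, hp, if_true, if_false] using ha
      · simpa only [f', h0, hp, if_false] using had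

/-- A map that meets the open set `O` in at most one point, and is not constant, misses `O`. -/
theorem union_of_subset_singleton [PreconnectedSpace P] [TopologicalSpace E] [T1Space E]
    {f₀ : C(P, E)} {S : Set P} (hSne : S.Nonempty) {U O : Set E} (h : Avoidable f₀ S U)
    (hO : IsOpen O) {a : E} (hOU : ∀ y ∈ O, y ∉ U → y = a) (hS : ∀ x ∈ S, f₀ x ∉ O) :
    Avoidable f₀ S (U ∪ O) := by
  obtain ⟨f, hf, hU⟩ := h
  obtain ⟨x₀, hx₀⟩ := hSne
  have hx₀O : f x₀ ∉ O := hf hx₀ ▸ hS x₀ hx₀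
  refine ⟨f, hf, fun x => ?_⟩
  rintro (hx | hx)
  · exact hU x hx
  have hmem : a ∈ O := hOU _ hx (hU x) ▸ hx
  have heq : f ⁻¹' O = f ⁻¹' {a} := by
    ext y
    exact ⟨fun hy => hOU _ hy (hU y), fun hy => by
      rw [Set.mem_preimage, show f y = a from hy]
      exact hmem⟩
  have hclopen : IsClopen (f ⁻¹' O) :=
    ⟨heq ▸ isClosed_singleton.preimage f.continuous, hO.preimage f.continuous⟩
  have := hclopen.eq_univ ⟨x, hx⟩
  exact hx₀O (Set.eq_univ_iff_forall.1 this x₀)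

end Avoidable

namespace Avoidable

theorem union_biUnion {P E ι : Type*} [TopologicalSpace P] [TopologicalSpace E] {f₀ : C(P, E)}
    {S : Set P} (I : Set E → Prop) (T : ι → Set E) (F : Finset ι)
    (hI : ∀ U, ∀ i ∈ F, I U → I (U ∪ T i))
    (hstep : ∀ U, ∀ i ∈ F, I U → Avoidable f₀ S U → Avoidable f₀ S (U ∪ T i))
    {U : Set E} (hU : I U) (h : Avoidable f₀ S U) :
    I (U ∪ ⋃ i ∈ F, T i) ∧ Avoidable f₀ S (U ∪ ⋃ i ∈ F, T i) := by
  classical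
  induction F using Finset.induction_on with
  | empty => simpa using ⟨hU, h⟩
  | insert a F _ ih =>
    obtain ⟨h1, h2⟩ := ih (fun U i hi => hI U i (Finset.mem_insert_of_mem hi))
      (fun U i hi => hstep U i (Finset.mem_insert_of_mem hi))
    have heq : U ∪ ⋃ i ∈ insert a F, T i = (U ∪ ⋃ i ∈ F, T i) ∪ T a := by
      rw [Finset.set_biUnion_insert, Set.union_comm (T a), Set.union_assoc]
    rw [heq]
    exact ⟨hI _ a (Finset.mem_insert_self a F) h1, hstep _ a (Finset.mem_insert_self a F) h1 h2⟩

end Avoidable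

namespace UnitGrid

/-- The open unit cell with lower left corner `(i, j)`. -/
def cell (i j : ℤ) : Set (ℝ × ℝ) := Set.Ioo (i : ℝ) (i + 1) ×ˢ Set.Ioo (j : ℝ) (j + 1)

/-- The closed unit cell with lower left corner `(i, j)`. -/
def closedCell (i j : ℤ) : Set (ℝ × ℝ) := Set.Icc (i : ℝ) (i + 1) ×ˢ Set.Icc (j : ℝ) (j + 1)

/-- The closed square of half-width `N` around the origin. -/
def box (N : ℤ) : Set (ℝ × ℝ) := Set.Icc (-N : ℝ) N ×ˢ Set.Icc (-N : ℝ) N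

/-- The union of all grid lines. -/
def lines : Set (ℝ × ℝ) := {p | ∃ n : ℤ, p.1 = n ∨ p.2 = n}

/-- The cells that can be reached from outside `box N` by crossing edges between cells whose
closures do not meet `K`. -/
inductive Reach (K : Set (ℝ × ℝ)) (N : ℤ) : ℤ → ℤ → Prop
  | far (i j : ℤ) (h : i < -N ∨ N ≤ i ∨ j < -N ∨ N ≤ j) : Reach K N i j
  | horizontal (i i' j : ℤ) (h : Reach K N i j) (hi : i' = i + 1 ∨ i = i' + 1)
      (hK : Disjoint (closedCell i' j) K) : Reach K N i' j
  | vertical (i j j' : ℤ) (h : Reach K N i j) (hj : j' = j + 1 ∨ j = j' + 1)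
      (hK : Disjoint (closedCell i j') K) : Reach K N i j'

variable {K : Set (ℝ × ℝ)} {N : ℤ}

theorem mem_cell {i j : ℤ} {p : ℝ × ℝ} :
    p ∈ cell i j ↔ (i < p.1 ∧ p.1 < i + 1) ∧ (j < p.2 ∧ p.2 < j + 1) := Iff.rfl

theorem mem_closedCell {i j : ℤ} {p : ℝ × ℝ} :
    p ∈ closedCell i j ↔ (i ≤ p.1 ∧ p.1 ≤ i + 1) ∧ (j ≤ p.2 ∧ p.2 ≤ j + 1) := Iff.rfl

theorem mem_box {p : ℝ × ℝ} :
    p ∈ box N ↔ (-N ≤ p.1 ∧ p.1 ≤ N) ∧ (-N ≤ p.2 ∧ p.2 ≤ N) := Iff.rfl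

theorem Reach.notMem (hK : K ⊆ interior (box N)) {i j : ℤ} (h : Reach K N i j) {p : ℝ × ℝ}
    (hp : p ∈ closedCell i j) : p ∉ K := by
  cases h with
  | horizontal _ _ _ _ _ hd => exact fun h => Set.disjoint_left.1 hd hp h
  | vertical _ _ _ _ _ hd => exact fun h => Set.disjoint_left.1 hd hp h
  | far _ _ hfar =>
    intro hpK
    have h := hK hpK
    rw [box, interior_prod_eq, interior_Icc, Set.mem_prod, Set.mem_Ioo, Set.mem_Ioo] at h
    rw [mem_closedCell] at hp
    rcases hfar with h1 | h1 | h1 | h1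
    · have : (i : ℝ) + 1 ≤ -N := by exact_mod_cast h1
      linarith [h.1.1, hp.1.2]
    · have : (N : ℝ) ≤ i := by exact_mod_cast h1
      linarith [h.1.2, hp.1.1]
    · have : (j : ℝ) + 1 ≤ -N := by exact_mod_cast h1
      linarith [h.2.1, hp.2.2]
    · have : (N : ℝ) ≤ j := by exact_mod_cast h1
      linarith [h.2.2, hp.2.1]

theorem notMem_lines_of_mem_cell {i j : ℤ} {p : ℝ × ℝ} (hp : p ∈ cell i j) : p ∉ lines := by
  rw [mem_cell] at hp
  rintro ⟨n, h | h⟩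
  · rw [h] at hp
    have h1 : i < n := by exact_mod_cast hp.1.1
    have h2 : n < i + 1 := by exact_mod_cast hp.1.2
    omega
  · rw [h] at hp
    have h1 : j < n := by exact_mod_cast hp.2.1
    have h2 : n < j + 1 := by exact_mod_cast hp.2.2
    omega

/-- The part of the plane avoided from the start. -/
def outer (N : ℤ) : Set (ℝ × ℝ) := {p | p ∉ box N ∧ (p ∉ lines ∨ p ∉ box (N + 1))}

theorem cell_subset_outer {i j : ℤ} (h : i < -N ∨ N ≤ i ∨ j < -N ∨ N ≤ j) :
    cell i j ⊆ outer N := by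
  intro p hp
  refine ⟨?_, Or.inl (notMem_lines_of_mem_cell hp)⟩
  rw [mem_cell] at hp
  rw [mem_box]
  rintro hb
  rcases h with h1 | h1 | h1 | h1
  · have : (i : ℝ) + 1 ≤ -N := by exact_mod_cast h1
    linarith [hb.1.1, hp.1.2]
  · have : (N : ℝ) ≤ i := by exact_mod_cast h1
    linarith [hb.1.2, hp.1.1]
  · have : (j : ℝ) + 1 ≤ -N := by exact_mod_cast h1
    linarith [hb.2.1, hp.2.2]
  · have : (N : ℝ) ≤ j := by exact_mod_cast h1
    linarith [hb.2.2, hp.2.1]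

theorem mem_outer_of_notMem_box {p : ℝ × ℝ} (hp : p ∉ box (N + 1)) : p ∈ outer N := by
  refine ⟨fun h => hp ?_, Or.inr hp⟩
  rw [mem_box] at h ⊢
  push_cast
  exact ⟨⟨by linarith [h.1.1], by linarith [h.1.2]⟩, ⟨by linarith [h.2.1], by linarith [h.2.2]⟩⟩

variable {P : Type*} [TopologicalSpace P] {f₀ : C(P, ℝ × ℝ)} {S : Set P}

/-- Pushing off the interior of an integer rectangle inside `box (N + 1)`. -/
theorem avoidable_union_rectangle {U : Set (ℝ × ℝ)} (h : Avoidable f₀ S U)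
    (hU : ∀ p ∈ U, p ∈ lines → p ∉ box (N + 1)) {a b c d : ℤ} (ha : -N - 1 ≤ a) (hb : b ≤ N + 1)
    (hc : -N - 1 ≤ c) (hd : d ≤ N + 1) {w : ℝ × ℝ}
    (hw : w ∈ Set.Ioo (a : ℝ) b ×ˢ Set.Ioo (c : ℝ) d) (hwU : w ∈ U)
    (hS : ∀ x ∈ S, f₀ x ∉ Set.Ioo (a : ℝ) b ×ˢ Set.Ioo (c : ℝ) d) :
    Avoidable f₀ S (U ∪ Set.Ioo (a : ℝ) b ×ˢ Set.Ioo (c : ℝ) d) := by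
  have hint : interior (Set.Icc (a : ℝ) b ×ˢ Set.Icc (c : ℝ) d) =
      Set.Ioo (a : ℝ) b ×ˢ Set.Ioo (c : ℝ) d := by
    rw [interior_prod_eq, interior_Icc, interior_Icc]
  have hcl : IsClosed (Set.Icc (a : ℝ) b ×ˢ Set.Icc (c : ℝ) d) := isClosed_Icc.prod isClosed_Icc
  rw [← hint]
  refine h.union_interior ((convex_Icc _ _).prod (convex_Icc _ _))
    (Metric.isBounded_Icc _ _ |>.prod (Metric.isBounded_Icc _ _)) (w := w) (by rwa [hint]) hwU ?_
    (by rwa [hint])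
  intro y hy hyU
  rw [hcl.frontier_eq, hint] at hy
  obtain ⟨⟨⟨h1, h2⟩, ⟨h3, h4⟩⟩, hn⟩ := hy
  have ha' : -(N : ℝ) - 1 ≤ a := by exact_mod_cast ha
  have hb' : (b : ℝ) ≤ N + 1 := by exact_mod_cast hb
  have hc' : -(N : ℝ) - 1 ≤ c := by exact_mod_cast hc
  have hd' : (d : ℝ) ≤ N + 1 := by exact_mod_cast hd
  refine hU y hyU ?_ ?_
  · by_contra hL
    simp only [lines, Set.mem_ofPred_eq, not_exists, not_or] at hL
    exact hn ⟨⟨lt_of_le_of_ne h1 (Ne.symm (hL a).1), lt_of_le_of_ne h2 (hL b).1⟩,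
      ⟨lt_of_le_of_ne h3 (Ne.symm (hL c).2), lt_of_le_of_ne h4 (hL d).2⟩⟩
  · rw [mem_box]
    push_cast
    exact ⟨⟨by linarith, by linarith⟩, ⟨by linarith, by linarith⟩⟩

theorem avoidable_union_cell {i j : ℤ} (hR : Reach (f₀ '' S) N i j) {U : Set (ℝ × ℝ)}
    (h : Avoidable f₀ S U) (hout : outer N ⊆ U) (hU : ∀ p ∈ U, p ∈ lines → p ∉ box (N + 1)) :
    Avoidable f₀ S (U ∪ cell i j) := by
  have hinv : ∀ k l : ℤ, ∀ p ∈ U ∪ cell k l, p ∈ lines → p ∉ box (N + 1) := by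
    rintro k l p (hp | hp) hl
    exacts [hU p hp hl, absurd hl (notMem_lines_of_mem_cell hp)]
  induction hR with
  | far i j hfar =>
    exact h.mono (Set.union_subset subset_rfl ((cell_subset_outer hfar).trans hout))
  | horizontal i i' j _ hi hK ih =>
    by_cases hfar : i' < -N ∨ N ≤ i' ∨ j < -N ∨ N ≤ j
    · exact h.mono (Set.union_subset subset_rfl ((cell_subset_outer hfar).trans hout))
    push Not at hfar
    obtain ⟨m, hm⟩ : ∃ m : ℤ, (m = i ∧ i' = m + 1) ∨ (m = i' ∧ i = m + 1) := by
      rcases hi with hi | hi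
      exacts [⟨i, Or.inl ⟨rfl, hi⟩⟩, ⟨i', Or.inr ⟨rfl, hi⟩⟩]
    have hw : ((i : ℝ) + 1 / 2, (j : ℝ) + 1 / 2) ∈ cell i j := by
      rw [mem_cell]
      norm_num
    have hmi : ((i : ℝ) = m ∧ (i' : ℝ) = m + 1) ∨ ((i' : ℝ) = m ∧ (i : ℝ) = m + 1) := by
      rcases hm with ⟨rfl, rfl⟩ | ⟨rfl, rfl⟩ <;> simp
    have := avoidable_union_rectangle ih (hinv i j) (a := m) (b := m + 2) (c := j) (d := j + 1)
      (by omega) (by omega) (by omega) (by omega)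
      (w := ((i : ℝ) + 1 / 2, (j : ℝ) + 1 / 2))
      (by
        simp only [Set.mem_prod, Set.mem_Ioo]
        push_cast
        rcases hmi with ⟨h1, h2⟩ | ⟨h1, h2⟩ <;>
          exact ⟨⟨by linarith, by linarith⟩, by linarith, by linarith⟩)
      (Or.inr hw)
      (by
        intro x hx hmem
        have hn := ih.notMem hx
        have hn' : f₀ x ∉ closedCell i' j :=
          fun hc => Set.disjoint_left.1 hK hc (Set.mem_image_of_mem _ hx)
        simp only [Set.mem_prod, Set.mem_Ioo] at hmem
        push_cast at hmem
        obtain ⟨⟨h1, h2⟩, h3, h4⟩ := hmem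
        refine hn (Or.inr ?_)
        rw [mem_closedCell] at hn'
        rw [mem_cell]
        by_contra hcon
        rcases hmi with ⟨e1, e2⟩ | ⟨e1, e2⟩
        · refine hcon ⟨⟨by linarith, ?_⟩, h3, h4⟩
          by_contra! h5
          exact hn' ⟨⟨by linarith, by linarith⟩, h3.le, h4.le⟩
        · refine hcon ⟨⟨?_, by linarith⟩, h3, h4⟩
          by_contra! h5
          exact hn' ⟨⟨by linarith, by linarith⟩, h3.le, h4.le⟩)
    refine this.mono (Set.union_subset (fun p hp => Or.inl (Or.inl hp)) fun p hp => Or.inr ?_)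
    rw [mem_cell] at hp
    simp only [Set.mem_prod, Set.mem_Ioo]
    push_cast
    rcases hmi with ⟨h1, h2⟩ | ⟨h1, h2⟩ <;>
      exact ⟨⟨by linarith [hp.1.1], by linarith [hp.1.2]⟩, hp.2⟩
  | vertical i j j' _ hj hK ih =>
    by_cases hfar : i < -N ∨ N ≤ i ∨ j' < -N ∨ N ≤ j'
    · exact h.mono (Set.union_subset subset_rfl ((cell_subset_outer hfar).trans hout))
    push Not at hfar
    obtain ⟨m, hm⟩ : ∃ m : ℤ, (m = j ∧ j' = m + 1) ∨ (m = j' ∧ j = m + 1) := by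
      rcases hj with hj | hj
      exacts [⟨j, Or.inl ⟨rfl, hj⟩⟩, ⟨j', Or.inr ⟨rfl, hj⟩⟩]
    have hw : ((i : ℝ) + 1 / 2, (j : ℝ) + 1 / 2) ∈ cell i j := by
      rw [mem_cell]
      norm_num
    have hmj : ((j : ℝ) = m ∧ (j' : ℝ) = m + 1) ∨ ((j' : ℝ) = m ∧ (j : ℝ) = m + 1) := by
      rcases hm with ⟨rfl, rfl⟩ | ⟨rfl, rfl⟩ <;> simp
    have := avoidable_union_rectangle ih (hinv i j) (a := i) (b := i + 1) (c := m) (d := m + 2)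
      (by omega) (by omega) (by omega) (by omega)
      (w := ((i : ℝ) + 1 / 2, (j : ℝ) + 1 / 2))
      (by
        simp only [Set.mem_prod, Set.mem_Ioo]
        push_cast
        rcases hmj with ⟨h1, h2⟩ | ⟨h1, h2⟩ <;>
          exact ⟨⟨by linarith, by linarith⟩, by linarith, by linarith⟩)
      (Or.inr hw)
      (by
        intro x hx hmem
        have hn := ih.notMem hx
        have hn' : f₀ x ∉ closedCell i j' :=
          fun hc => Set.disjoint_left.1 hK hc (Set.mem_image_of_mem _ hx)
        simp only [Set.mem_prod, Set.mem_Ioo] at hmem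
        push_cast at hmem
        obtain ⟨⟨h1, h2⟩, h3, h4⟩ := hmem
        refine hn (Or.inr ?_)
        rw [mem_closedCell] at hn'
        rw [mem_cell]
        by_contra hcon
        rcases hmj with ⟨e1, e2⟩ | ⟨e1, e2⟩
        · refine hcon ⟨⟨h1, h2⟩, by linarith, ?_⟩
          by_contra! h5
          exact hn' ⟨⟨h1.le, h2.le⟩, by linarith, by linarith⟩
        · refine hcon ⟨⟨h1, h2⟩, ?_, by linarith⟩
          by_contra! h5
          exact hn' ⟨⟨h1.le, h2.le⟩, by linarith, by linarith⟩)
    refine this.mono (Set.union_subset (fun p hp => Or.inl (Or.inl hp)) fun p hp => Or.inr ?_)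
    rw [mem_cell] at hp
    simp only [Set.mem_prod, Set.mem_Ioo]
    push_cast
    rcases hmj with ⟨h1, h2⟩ | ⟨h1, h2⟩ <;>
      exact ⟨hp.1, by linarith [hp.2.1], by linarith [hp.2.2]⟩

/-- The open vertical edge from `(i, j)` to `(i, j + 1)` together with its two adjacent cells. -/
def verticalDomino (i j : ℤ) : Set (ℝ × ℝ) :=
  Set.Ioo (i - 1 : ℝ) (i + 1) ×ˢ Set.Ioo (j : ℝ) (j + 1)

/-- The open horizontal edge from `(i, j)` to `(i + 1, j)` together with its two adjacent cells. -/
def horizontalDomino (i j : ℤ) : Set (ℝ × ℝ) :=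
  Set.Ioo (i : ℝ) (i + 1) ×ˢ Set.Ioo (j - 1 : ℝ) (j + 1)

/-- The open square formed by the four cells around the grid point `(i, j)`. -/
def vertexStar (i j : ℤ) : Set (ℝ × ℝ) :=
  Set.Ioo (i - 1 : ℝ) (i + 1) ×ˢ Set.Ioo (j - 1 : ℝ) (j + 1)

theorem mem_verticalDomino {i j : ℤ} {p : ℝ × ℝ} :
    p ∈ verticalDomino i j ↔ (i - 1 < p.1 ∧ p.1 < i + 1) ∧ (j < p.2 ∧ p.2 < j + 1) := Iff.rfl

theorem mem_horizontalDomino {i j : ℤ} {p : ℝ × ℝ} :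
    p ∈ horizontalDomino i j ↔ (i < p.1 ∧ p.1 < i + 1) ∧ (j - 1 < p.2 ∧ p.2 < j + 1) := Iff.rfl

theorem mem_vertexStar {i j : ℤ} {p : ℝ × ℝ} :
    p ∈ vertexStar i j ↔ (i - 1 < p.1 ∧ p.1 < i + 1) ∧ (j - 1 < p.2 ∧ p.2 < j + 1) := Iff.rfl

/-- `U` contains `outer N` and all reachable cells. -/
structure ContainsCells (K : Set (ℝ × ℝ)) (N : ℤ) (U : Set (ℝ × ℝ)) : Prop where
  outer : outer N ⊆ U
  cell : ∀ i j, Reach K N i j → cell i j ⊆ U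

/-- `U` contains no grid point of `box (N + 1)`. -/
def AvoidsVertices (N : ℤ) (U : Set (ℝ × ℝ)) : Prop :=
  ∀ i j : ℤ, ((i : ℝ), (j : ℝ)) ∈ box (N + 1) → ((i : ℝ), (j : ℝ)) ∉ U

theorem ContainsCells.mono {U V : Set (ℝ × ℝ)} (h : ContainsCells K N U) (hUV : U ⊆ V) :
    ContainsCells K N V :=
  ⟨h.outer.trans hUV, fun i j hR => (h.cell i j hR).trans hUV⟩

theorem ContainsCells.mem {U : Set (ℝ × ℝ)} (h : ContainsCells K N U) {p : ℝ × ℝ}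
    (hp : p ∉ box (N + 1)) : p ∈ U :=
  h.outer (mem_outer_of_notMem_box hp)

theorem mem_closedCell_of_mem_verticalDomino {i j : ℤ} {p : ℝ × ℝ} (h : p ∈ verticalDomino i j) :
    p ∈ closedCell (i - 1) j ∨ p ∈ closedCell i j := by
  rw [mem_verticalDomino] at h
  simp only [mem_closedCell]
  push_cast
  rcases le_total p.1 i with h1 | h1
  · exact Or.inl ⟨⟨h.1.1.le, by linarith⟩, h.2.1.le, h.2.2.le⟩
  · exact Or.inr ⟨⟨h1, h.1.2.le⟩, h.2.1.le, h.2.2.le⟩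

theorem mem_closedCell_of_mem_horizontalDomino {i j : ℤ} {p : ℝ × ℝ}
    (h : p ∈ horizontalDomino i j) : p ∈ closedCell i (j - 1) ∨ p ∈ closedCell i j := by
  rw [mem_horizontalDomino] at h
  simp only [mem_closedCell]
  push_cast
  rcases le_total p.2 j with h1 | h1
  · exact Or.inl ⟨⟨h.1.1.le, h.1.2.le⟩, h.2.1.le, by linarith⟩
  · exact Or.inr ⟨⟨h.1.1.le, h.1.2.le⟩, h1, h.2.2.le⟩

theorem notMem_of_mem_verticalDomino (hK : K ⊆ interior (box N)) {i j : ℤ}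
    (hR : Reach K N (i - 1) j ∧ Reach K N i j) {p : ℝ × ℝ} (hp : p ∈ verticalDomino i j) :
    p ∉ K := by
  rcases mem_closedCell_of_mem_verticalDomino hp with h | h
  exacts [hR.1.notMem hK h, hR.2.notMem hK h]

theorem notMem_of_mem_horizontalDomino (hK : K ⊆ interior (box N)) {i j : ℤ}
    (hR : Reach K N i (j - 1) ∧ Reach K N i j) {p : ℝ × ℝ} (hp : p ∈ horizontalDomino i j) :
    p ∉ K := by
  rcases mem_closedCell_of_mem_horizontalDomino hp with h | h
  exacts [hR.1.notMem hK h, hR.2.notMem hK h]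

theorem AvoidsVertices.union_verticalDomino {U : Set (ℝ × ℝ)} (h : AvoidsVertices N U) (i j : ℤ) :
    AvoidsVertices N (U ∪ verticalDomino i j) := by
  rintro m n hmn (hp | hp)
  · exact h m n hmn hp
  · rw [mem_verticalDomino] at hp
    dsimp only at hp
    have h1 : j < n := by exact_mod_cast hp.2.1
    have h2 : n < j + 1 := by exact_mod_cast hp.2.2
    omega

theorem AvoidsVertices.union_horizontalDomino {U : Set (ℝ × ℝ)} (h : AvoidsVertices N U)
    (i j : ℤ) : AvoidsVertices N (U ∪ horizontalDomino i j) := by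
  rintro m n hmn (hp | hp)
  · exact h m n hmn hp
  · rw [mem_horizontalDomino] at hp
    dsimp only at hp
    have h1 : i < m := by exact_mod_cast hp.1.1
    have h2 : m < i + 1 := by exact_mod_cast hp.1.2
    omega

theorem mem_box_intCast {i j : ℤ} (hi : -N - 1 ≤ i ∧ i ≤ N + 1) (hj : -N - 1 ≤ j ∧ j ≤ N + 1) :
    ((i : ℝ), (j : ℝ)) ∈ box (N + 1) := by
  obtain ⟨⟨h1, h2⟩, h3, h4⟩ : (-N - 1 ≤ (i : ℝ) ∧ i ≤ (N : ℝ) + 1) ∧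
      (-N - 1 ≤ (j : ℝ) ∧ j ≤ (N : ℝ) + 1) := by exact_mod_cast And.intro hi hj
  rw [mem_box]
  push_cast
  exact ⟨⟨by linarith, h2⟩, by linarith, h4⟩

theorem avoidable_union_verticalDomino [SimplyConnectedSpace P] [LocallyPathConnectedSpace P]
    (hSc : IsConnected S) (hK : f₀ '' S ⊆ interior (box N)) {U : Set (ℝ × ℝ)}
    (h : Avoidable f₀ S U) (hc : ContainsCells (f₀ '' S) N U) (hv : AvoidsVertices N U) {i j : ℤ}
    (hi : -N - 1 ≤ i ∧ i ≤ N + 1) (hj : -N - 1 ≤ j ∧ j ≤ N)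
    (hR : Reach (f₀ '' S) N (i - 1) j ∧ Reach (f₀ '' S) N i j) :
    Avoidable f₀ S (U ∪ verticalDomino i j) := by
  have hv' := hv.union_verticalDomino i j
  refine h.union_of_subset_segment hSc (isOpen_Ioo.prod isOpen_Ioo) (a := ((i : ℝ), (j : ℝ)))
    (d := (0, 1)) (ℓ := ContinuousLinearMap.snd ℝ ℝ ℝ) (by simp) ?_ ?_
    (hv' i j (mem_box_intCast hi (by omega))) ?_
    fun x hx hm => notMem_of_mem_verticalDomino hK hR hm (Set.mem_image_of_mem _ hx)
  · intro y hy hyU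
    have hy' := mem_verticalDomino.1 hy
    rcases lt_trichotomy y.1 i with hlt | heq | hgt
    · refine absurd (hc.cell _ _ hR.1 ?_) hyU
      rw [mem_cell]
      push_cast
      exact ⟨⟨hy'.1.1, by linarith⟩, hy'.2⟩
    · exact ⟨y.2 - j, ⟨by linarith [hy'.2.1], by linarith [hy'.2.2]⟩, by ext <;> simp [heq]⟩
    · exact absurd (hc.cell _ _ hR.2 ⟨⟨hgt, hy'.1.2⟩, hy'.2⟩) hyU
  · intro t ht
    rw [mem_verticalDomino]
    simpa using ht
  · have := hv' i (j + 1) (mem_box_intCast hi (by omega))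
    simpa using! this

theorem avoidable_union_horizontalDomino [SimplyConnectedSpace P] [LocallyPathConnectedSpace P]
    (hSc : IsConnected S) (hK : f₀ '' S ⊆ interior (box N)) {U : Set (ℝ × ℝ)}
    (h : Avoidable f₀ S U) (hc : ContainsCells (f₀ '' S) N U) (hv : AvoidsVertices N U) {i j : ℤ}
    (hi : -N - 1 ≤ i ∧ i ≤ N) (hj : -N - 1 ≤ j ∧ j ≤ N + 1)
    (hR : Reach (f₀ '' S) N i (j - 1) ∧ Reach (f₀ '' S) N i j) :
    Avoidable f₀ S (U ∪ horizontalDomino i j) := by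
  have hv' := hv.union_horizontalDomino i j
  refine h.union_of_subset_segment hSc (isOpen_Ioo.prod isOpen_Ioo) (a := ((i : ℝ), (j : ℝ)))
    (d := (1, 0)) (ℓ := ContinuousLinearMap.fst ℝ ℝ ℝ) (by simp) ?_ ?_
    (hv' i j (mem_box_intCast (by omega) hj)) ?_
    fun x hx hm => notMem_of_mem_horizontalDomino hK hR hm (Set.mem_image_of_mem _ hx)
  · intro y hy hyU
    have hy' := mem_horizontalDomino.1 hy
    rcases lt_trichotomy y.2 j with hlt | heq | hgt
    · refine absurd (hc.cell _ _ hR.1 ?_) hyU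
      rw [mem_cell]
      push_cast
      exact ⟨hy'.1, hy'.2.1, by linarith⟩
    · exact ⟨y.1 - i, ⟨by linarith [hy'.1.1], by linarith [hy'.1.2]⟩, by ext <;> simp [heq]⟩
    · exact absurd (hc.cell _ _ hR.2 ⟨hy'.1, hgt, hy'.2.2⟩) hyU
  · intro t ht
    rw [mem_horizontalDomino]
    simpa using ht
  · have := hv' (i + 1) j (mem_box_intCast (by omega) hj)
    simpa using! this

theorem notMem_box_of_mem_star {i j : ℤ} {p : ℝ × ℝ} (hp : p ∈ vertexStar i j)
    (h : ¬ ((-N - 1 ≤ i ∧ i ≤ N + 1) ∧ (-N - 1 ≤ j ∧ j ≤ N + 1))) : p ∉ box (N + 1) := by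
  rw [mem_vertexStar] at hp
  rw [mem_box]
  push_cast
  rintro ⟨⟨h1, h2⟩, h3, h4⟩
  refine h ⟨⟨?_, ?_⟩, ?_, ?_⟩
  · have : -(N : ℝ) - 1 < i + 1 := by linarith
    have : -N - 1 < i + 1 := by exact_mod_cast this
    omega
  · have : (i : ℝ) - 1 < N + 1 := by linarith
    have : i - 1 < N + 1 := by exact_mod_cast this
    omega
  · have : -(N : ℝ) - 1 < j + 1 := by linarith
    have : -N - 1 < j + 1 := by exact_mod_cast this
    omega
  · have : (j : ℝ) - 1 < N + 1 := by linarith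
    have : j - 1 < N + 1 := by exact_mod_cast this
    omega

theorem notMem_box_of_mem_verticalDomino {i j : ℤ} {p : ℝ × ℝ} (hp : p ∈ verticalDomino i j)
    (h : ¬ ((-N - 1 ≤ i ∧ i ≤ N + 1) ∧ (-N - 1 ≤ j ∧ j ≤ N))) : p ∉ box (N + 1) := by
  rw [mem_verticalDomino] at hp
  rw [mem_box]
  push_cast
  rintro ⟨⟨h1, h2⟩, h3, h4⟩
  refine h ⟨⟨?_, ?_⟩, ?_, ?_⟩
  · have : -(N : ℝ) - 1 < i + 1 := by linarith
    have : -N - 1 < i + 1 := by exact_mod_cast this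
    omega
  · have : (i : ℝ) - 1 < N + 1 := by linarith
    have : i - 1 < N + 1 := by exact_mod_cast this
    omega
  · have : -(N : ℝ) - 1 < j + 1 := by linarith
    have : -N - 1 < j + 1 := by exact_mod_cast this
    omega
  · have : (j : ℝ) < N + 1 := by linarith
    have : j < N + 1 := by exact_mod_cast this
    omega

theorem notMem_box_of_mem_horizontalDomino {i j : ℤ} {p : ℝ × ℝ} (hp : p ∈ horizontalDomino i j)
    (h : ¬ ((-N - 1 ≤ i ∧ i ≤ N) ∧ (-N - 1 ≤ j ∧ j ≤ N + 1))) : p ∉ box (N + 1) := by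
  rw [mem_horizontalDomino] at hp
  rw [mem_box]
  push_cast
  rintro ⟨⟨h1, h2⟩, h3, h4⟩
  refine h ⟨⟨?_, ?_⟩, ?_, ?_⟩
  · have : -(N : ℝ) - 1 < i + 1 := by linarith
    have : -N - 1 < i + 1 := by exact_mod_cast this
    omega
  · have : (i : ℝ) < N + 1 := by linarith
    have : i < N + 1 := by exact_mod_cast this
    omega
  · have : -(N : ℝ) - 1 < j + 1 := by linarith
    have : -N - 1 < j + 1 := by exact_mod_cast this
    omega
  · have : (j : ℝ) - 1 < N + 1 := by linarith
    have : j - 1 < N + 1 := by exact_mod_cast this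
    omega

theorem exists_avoidable_cells (h : Avoidable f₀ S (outer N)) :
    ∃ U, ContainsCells (f₀ '' S) N U ∧ AvoidsVertices N U ∧ Avoidable f₀ S U := by
  classical
  let F : Finset (ℤ × ℤ) := (Finset.Icc (-N) N ×ˢ Finset.Icc (-N) N).filter
    fun q => Reach (f₀ '' S) N q.1 q.2
  obtain ⟨⟨hI1, hI2⟩, hA⟩ := Avoidable.union_biUnion
    (fun U => outer N ⊆ U ∧ ∀ p ∈ U, p ∈ lines → p ∉ box (N + 1)) (fun q : ℤ × ℤ => cell q.1 q.2) F
    (fun U q _ hI => ⟨hI.1.trans Set.subset_union_left, by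
      rintro p (hp | hp) hl
      exacts [hI.2 p hp hl, absurd hl (notMem_lines_of_mem_cell hp)]⟩)
    (fun U q hq hI hA => avoidable_union_cell (Finset.mem_filter.1 hq).2 hA hI.1 hI.2)
    (U := outer N) ⟨subset_rfl, fun p hp hl => hp.2.resolve_left (not_not.2 hl)⟩ h
  refine ⟨_, ⟨hI1, fun i j hR => ?_⟩, fun i j hb hU => hI2 _ hU ⟨i, Or.inl rfl⟩ hb, hA⟩
  by_cases hfar : i < -N ∨ N ≤ i ∨ j < -N ∨ N ≤ j
  · exact (cell_subset_outer hfar).trans hI1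
  · refine fun p hp => Or.inr (Set.mem_biUnion (x := (i, j)) ?_ hp)
    simp only [F, Finset.coe_filter, Finset.mem_product, Finset.mem_Icc, Set.mem_ofPred_eq]
    exact ⟨by omega, hR⟩

theorem exists_avoidable_edges [SimplyConnectedSpace P] [LocallyPathConnectedSpace P]
    (hSc : IsConnected S) (hK : f₀ '' S ⊆ interior (box N)) (h : Avoidable f₀ S (outer N)) :
    ∃ U, ContainsCells (f₀ '' S) N U ∧
      (∀ i j, Reach (f₀ '' S) N (i - 1) j ∧ Reach (f₀ '' S) N i j → verticalDomino i j ⊆ U) ∧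
      (∀ i j, Reach (f₀ '' S) N i (j - 1) ∧ Reach (f₀ '' S) N i j → horizontalDomino i j ⊆ U) ∧
      Avoidable f₀ S U := by
  classical
  obtain ⟨U₁, hc₁, hv₁, hA₁⟩ := exists_avoidable_cells h
  let F : Finset (ℤ × ℤ) := (Finset.Icc (-N - 1) (N + 1) ×ˢ Finset.Icc (-N - 1) N).filter
    fun q => Reach (f₀ '' S) N (q.1 - 1) q.2 ∧ Reach (f₀ '' S) N q.1 q.2
  obtain ⟨⟨hc₂, hv₂⟩, hA₂⟩ := Avoidable.union_biUnion
    (fun U => ContainsCells (f₀ '' S) N U ∧ AvoidsVertices N U)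
    (fun q : ℤ × ℤ => verticalDomino q.1 q.2) F
    (fun U q _ hI => ⟨hI.1.mono Set.subset_union_left, hI.2.union_verticalDomino _ _⟩)
    (fun U q hq hI hA => by
      simp only [F, Finset.mem_filter, Finset.mem_product, Finset.mem_Icc] at hq
      exact avoidable_union_verticalDomino hSc hK hA hI.1 hI.2 hq.1.1 hq.1.2 hq.2)
    ⟨hc₁, hv₁⟩ hA₁
  let G : Finset (ℤ × ℤ) := (Finset.Icc (-N - 1) N ×ˢ Finset.Icc (-N - 1) (N + 1)).filter
    fun q => Reach (f₀ '' S) N q.1 (q.2 - 1) ∧ Reach (f₀ '' S) N q.1 q.2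
  obtain ⟨⟨hc₃, -⟩, hA₃⟩ := Avoidable.union_biUnion
    (fun U => ContainsCells (f₀ '' S) N U ∧ AvoidsVertices N U)
    (fun q : ℤ × ℤ => horizontalDomino q.1 q.2) G
    (fun U q _ hI => ⟨hI.1.mono Set.subset_union_left, hI.2.union_horizontalDomino _ _⟩)
    (fun U q hq hI hA => by
      simp only [G, Finset.mem_filter, Finset.mem_product, Finset.mem_Icc] at hq
      exact avoidable_union_horizontalDomino hSc hK hA hI.1 hI.2 hq.1.1 hq.1.2 hq.2)
    ⟨hc₂, hv₂⟩ hA₂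
  refine ⟨_, hc₃, fun i j hR p hp => ?_, fun i j hR p hp => ?_, hA₃⟩
  · by_cases hr : (-N - 1 ≤ i ∧ i ≤ N + 1) ∧ (-N - 1 ≤ j ∧ j ≤ N)
    · refine Or.inl (Or.inr (Set.mem_biUnion (x := (i, j)) ?_ hp))
      simp only [F, Finset.coe_filter, Finset.mem_product, Finset.mem_Icc, Set.mem_ofPred_eq]
      exact ⟨hr, hR⟩
    · exact hc₃.mem (notMem_box_of_mem_verticalDomino hp hr)
  · by_cases hr : (-N - 1 ≤ i ∧ i ≤ N) ∧ (-N - 1 ≤ j ∧ j ≤ N + 1)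
    · refine Or.inr (Set.mem_biUnion (x := (i, j)) ?_ hp)
      simp only [G, Finset.coe_filter, Finset.mem_product, Finset.mem_Icc, Set.mem_ofPred_eq]
      exact ⟨hr, hR⟩
    · exact hc₃.mem (notMem_box_of_mem_horizontalDomino hp hr)

/-- All four cells around the grid point `(i, j)` are reachable. -/
def StarReach (K : Set (ℝ × ℝ)) (N i j : ℤ) : Prop :=
  (Reach K N (i - 1) (j - 1) ∧ Reach K N (i - 1) j) ∧ (Reach K N i (j - 1) ∧ Reach K N i j)

/-- A map whose values on `S` lie in the interior of `box N` can be modified off `S` so that it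
avoids every point all of whose closed cells are reachable. -/
theorem avoidable_reach [SimplyConnectedSpace P] [LocallyPathConnectedSpace P]
    (hSc : IsConnected S) (hK : f₀ '' S ⊆ interior (box N)) (h : Avoidable f₀ S (outer N)) :
    Avoidable f₀ S {p | ∀ i j, p ∈ closedCell i j → Reach (f₀ '' S) N i j} := by
  classical
  obtain ⟨U, hc, hV, hH, hA⟩ := exists_avoidable_edges hSc hK h
  let F : Finset (ℤ × ℤ) := (Finset.Icc (-N - 1) (N + 1) ×ˢ Finset.Icc (-N - 1) (N + 1)).filter
    fun q => StarReach (f₀ '' S) N q.1 q.2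
  have hstar : ∀ i j, StarReach (f₀ '' S) N i j → ∀ p ∈ vertexStar i j,
      p ∈ U ∨ p = ((i : ℝ), (j : ℝ)) := by
    intro i j hR p hp
    rw [mem_vertexStar] at hp
    rcases lt_trichotomy p.2 j with hlt | heq | hgt
    · refine Or.inl (hV i (j - 1) ⟨hR.1.1, hR.2.1⟩ ?_)
      rw [mem_verticalDomino]
      push_cast
      exact ⟨hp.1, hp.2.1, by linarith⟩
    · rcases lt_trichotomy p.1 i with hlt' | heq' | hgt'
      · refine Or.inl (hH (i - 1) j ⟨hR.1.1, hR.1.2⟩ ?_)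
        rw [mem_horizontalDomino]
        push_cast
        exact ⟨⟨hp.1.1, by linarith⟩, hp.2⟩
      · exact Or.inr (Prod.ext heq' heq)
      · exact Or.inl (hH i j ⟨hR.2.1, hR.2.2⟩ ⟨⟨hgt', hp.1.2⟩, hp.2⟩)
    · exact Or.inl (hV i j ⟨hR.1.2, hR.2.2⟩ ⟨hp.1, hgt, hp.2.2⟩)
  obtain ⟨hUW, hA'⟩ := Avoidable.union_biUnion (fun W => U ⊆ W)
    (fun q : ℤ × ℤ => vertexStar q.1 q.2) F
    (fun W q _ hI => hI.trans Set.subset_union_left)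
    (fun W q hq hI hAW => by
      have hR := (Finset.mem_filter.1 hq).2
      refine hAW.union_of_subset_singleton hSc.nonempty (isOpen_Ioo.prod isOpen_Ioo)
        (a := ((q.1 : ℝ), (q.2 : ℝ)))
        (fun y hy hyW => (hstar _ _ hR y hy).resolve_left fun h => hyW (hI h)) ?_
      intro x hx hm
      rcases hstar _ _ hR _ hm with h1 | h1
      · exact hA.notMem hx h1
      · refine hR.2.2.notMem hK (p := f₀ x) ?_ (Set.mem_image_of_mem _ hx)
        rw [h1, mem_closedCell]
        simp)
    subset_rfl hA
  refine hA'.mono fun p hp => ?_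
  have hp' : ∀ i j : ℤ, (i ≤ p.1 ∧ p.1 ≤ i + 1) ∧ (j ≤ p.2 ∧ p.2 ≤ j + 1) →
      Reach (f₀ '' S) N i j := hp
  set i := ⌊p.1⌋
  set j := ⌊p.2⌋
  have hi1 : (i : ℝ) ≤ p.1 := Int.floor_le _
  have hi2 : p.1 < i + 1 := Int.lt_floor_add_one _
  have hj1 : (j : ℝ) ≤ p.2 := Int.floor_le _
  have hj2 : p.2 < j + 1 := Int.lt_floor_add_one _
  have h11 : Reach (f₀ '' S) N i j := hp' i j ⟨⟨hi1, hi2.le⟩, hj1, hj2.le⟩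
  rcases hi1.eq_or_lt with hi | hi
  · have h01 : Reach (f₀ '' S) N (i - 1) j := hp' (i - 1) j (by
      push_cast; exact ⟨⟨by linarith, by linarith⟩, hj1, hj2.le⟩)
    rcases hj1.eq_or_lt with hj | hj
    · have h10 : Reach (f₀ '' S) N i (j - 1) := hp' i (j - 1) (by
        push_cast; exact ⟨⟨by linarith, by linarith⟩, by linarith, by linarith⟩)
      have h00 : Reach (f₀ '' S) N (i - 1) (j - 1) := hp' (i - 1) (j - 1) (by
        push_cast; exact ⟨⟨by linarith, by linarith⟩, by linarith, by linarith⟩)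
      have hmem : p ∈ vertexStar i j :=
        ⟨⟨by linarith, by linarith⟩, by linarith, by linarith⟩
      by_cases hr : (-N - 1 ≤ i ∧ i ≤ N + 1) ∧ (-N - 1 ≤ j ∧ j ≤ N + 1)
      · refine Or.inr (Set.mem_biUnion (x := (i, j)) ?_ hmem)
        simp only [F, Finset.coe_filter, Finset.mem_product, Finset.mem_Icc, Set.mem_ofPred_eq]
        exact ⟨hr, ⟨h00, h01⟩, h10, h11⟩
      · exact hUW (hc.mem (notMem_box_of_mem_star hmem hr))
    · exact hUW (hV i j ⟨h01, h11⟩ ⟨⟨by linarith, by linarith⟩, hj, hj2⟩)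
  · rcases hj1.eq_or_lt with hj | hj
    · have h10 : Reach (f₀ '' S) N i (j - 1) := hp' i (j - 1) (by
        push_cast; exact ⟨⟨by linarith, by linarith⟩, by linarith, by linarith⟩)
      exact hUW (hH i j ⟨h10, h11⟩ ⟨⟨hi, hi2⟩, by linarith, by linarith⟩)
    · exact hUW (hc.cell i j h11 ⟨⟨hi, hi2⟩, hj, hj2⟩)

end UnitGrid

namespace UnitGrid

variable {K : Set (ℝ × ℝ)} {N : ℤ}

theorem isCompact_closedCell (i j : ℤ) : IsCompact (closedCell i j) :=
  isCompact_Icc.prod isCompact_Icc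

theorem locallyFinite_closedCell : LocallyFinite fun q : ℤ × ℤ => closedCell q.1 q.2 := by
  intro p
  refine ⟨Set.Ioo (p.1 - 1) (p.1 + 1) ×ˢ Set.Ioo (p.2 - 1) (p.2 + 1),
    prod_mem_nhds (Ioo_mem_nhds (by linarith) (by linarith))
      (Ioo_mem_nhds (by linarith) (by linarith)),
    Set.Finite.subset (Set.finite_Icc (⌊p.1⌋ - 2, ⌊p.2⌋ - 2) (⌊p.1⌋ + 2, ⌊p.2⌋ + 2)) ?_⟩
  rintro ⟨i, j⟩ ⟨y, hy, ⟨h1, h2⟩, h3, h4⟩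
  rw [mem_closedCell] at hy
  have e1 := Int.floor_le p.1
  have e2 := Int.lt_floor_add_one p.1
  have e3 := Int.floor_le p.2
  have e4 := Int.lt_floor_add_one p.2
  have k1 : (i : ℝ) < (⌊p.1⌋ + 2 : ℤ) := by push_cast; linarith [hy.1.1]
  have k2 : ((⌊p.1⌋ - 2 : ℤ) : ℝ) < i := by push_cast; linarith [hy.1.2]
  have k3 : (j : ℝ) < (⌊p.2⌋ + 2 : ℤ) := by push_cast; linarith [hy.2.1]
  have k4 : ((⌊p.2⌋ - 2 : ℤ) : ℝ) < j := by push_cast; linarith [hy.2.2]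
  rw [Int.cast_lt] at k1 k2 k3 k4
  exact ⟨⟨k2.le, k4.le⟩, k1.le, k3.le⟩

theorem dist_le_one_of_mem_closedCell {i j : ℤ} {p q : ℝ × ℝ} (hp : p ∈ closedCell i j)
    (hq : q ∈ closedCell i j) : dist p q ≤ 1 := by
  rw [mem_closedCell] at hp hq
  rw [Prod.dist_eq, Real.dist_eq, Real.dist_eq, max_le_iff, abs_le, abs_le]
  refine ⟨⟨?_, ?_⟩, ?_, ?_⟩ <;> linarith [hp.1.1, hp.1.2, hp.2.1, hp.2.2, hq.1.1, hq.1.2, hq.2.1,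
    hq.2.2]

/-- Reachability does not depend on the choice of a cell around a point far from `K`. -/
theorem Reach.of_mem_closedCell {c : ℝ × ℝ}
    (hc : ∀ i j, c ∈ closedCell i j → Disjoint (closedCell i j) K) {i j i' j' : ℤ}
    (hR : Reach K N i j) (h : c ∈ closedCell i j) (h' : c ∈ closedCell i' j') :
    Reach K N i' j' := by
  have hstep : ∀ {a b : ℤ} {t : ℝ}, (a ≤ t ∧ t ≤ a + 1) → (b ≤ t ∧ t ≤ b + 1) →
      b = a ∨ b = a + 1 ∨ a = b + 1 := by
    intro a b t ha hb
    have h1 : (a : ℝ) ≤ (b + 1 : ℤ) := by push_cast; linarith [ha.1, hb.2]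
    have h2 : (b : ℝ) ≤ (a + 1 : ℤ) := by push_cast; linarith [hb.1, ha.2]
    rw [Int.cast_le] at h1 h2
    omega
  have hmid : c ∈ closedCell i' j := ⟨h'.1, h.2⟩
  have hRmid : Reach K N i' j := by
    rcases hstep h.1 h'.1 with rfl | hi
    exacts [hR, hR.horizontal _ _ _ hi (hc _ _ hmid)]
  rcases hstep h.2 h'.2 with rfl | hj
  exacts [hRmid, hRmid.vertical _ _ _ hj (hc _ _ h')]

variable {P : Type*} [TopologicalSpace P] {f₀ : C(P, ℝ × ℝ)} {S : Set P}

/-- A map into the plane can be modified off `S` so that it avoids a closed set `C` without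
compact relatively clopen parts, if `C` is far from the values on `S`. -/
theorem avoidable_of_one_lt_dist [SimplyConnectedSpace P] [LocallyPathConnectedSpace P]
    (hSc : IsConnected S) (hSk : IsCompact S) {C : Set (ℝ × ℝ)} (hC : IsClosed C)
    (hcomp : ∀ T ⊆ C, IsCompact T → IsClosed (C \ T) → T = ∅)
    (hdist : ∀ x ∈ S, ∀ y ∈ C, 1 < dist (f₀ x) y) : Avoidable f₀ S C := by
  obtain ⟨r, hr⟩ := (hSk.image f₀.continuous).isBounded.subset_closedBall 0
  obtain ⟨n, hn⟩ := exists_nat_gt r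
  have hbd : ∀ x ∈ S, (-(n : ℝ) < (f₀ x).1 ∧ (f₀ x).1 < n) ∧
      (-(n : ℝ) < (f₀ x).2 ∧ (f₀ x).2 < n) := fun x hx => by
    have := hr (Set.mem_image_of_mem _ hx)
    rw [mem_closedBall_zero_iff, Prod.norm_def, max_le_iff, Real.norm_eq_abs, Real.norm_eq_abs]
      at this
    exact ⟨abs_lt.1 (this.1.trans_lt hn), abs_lt.1 (this.2.trans_lt hn)⟩
  let g : C(P, ℝ × ℝ) := ⟨fun x => (max (-(n : ℝ)) (min n (f₀ x).1),
    max (-(n : ℝ)) (min n (f₀ x).2)), by fun_prop⟩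
  have hg : Set.EqOn g f₀ S := fun x hx => by
    obtain ⟨⟨h1, h2⟩, h3, h4⟩ := hbd x hx
    exact Prod.ext (by simp [g, h1.le, h2.le]) (by simp [g, h3.le, h4.le])
  have himg : g '' S = f₀ '' S := hg.image_eq
  have hn0 : -(n : ℝ) ≤ n := by linarith [(Nat.cast_nonneg n : (0 : ℝ) ≤ n)]
  have hgout : Avoidable g S (outer n) :=
    ⟨g, Set.eqOn_refl _ _, fun x hx => hx.1 (by
      rw [mem_box]
      simp [g, hn0])⟩
  have hK : g '' S ⊆ interior (box n) := by
    rw [himg, box, interior_prod_eq, interior_Icc]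
    rintro _ ⟨x, hx, rfl⟩
    simpa [Set.mem_prod] using hbd x hx
  have hfar : ∀ c ∈ C, ∀ i j, c ∈ closedCell i j → Disjoint (closedCell i j) (g '' S) := by
    intro c hc i j hcij
    rw [Set.disjoint_left, himg]
    rintro _ hy ⟨x, hx, rfl⟩
    exact (hdist x hx c hc).not_ge (dist_le_one_of_mem_closedCell hy hcij)
  let R : Set (ℤ × ℤ) := {q | Reach (g '' S) n q.1 q.2}
  let T : Set (ℝ × ℝ) := C ∩ ⋃ q ∈ Rᶜ, closedCell q.1 q.2
  have hRfin : Rᶜ.Finite := by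
    refine (Set.finite_Icc (-(n : ℤ), -(n : ℤ)) ((n : ℤ), (n : ℤ))).subset ?_
    rintro ⟨i, j⟩ hq
    by_contra hcon
    refine hq (Reach.far i j ?_)
    rw [Set.mem_Icc, Prod.mk_le_mk, Prod.mk_le_mk] at hcon
    omega
  have hTcomp : IsCompact T :=
    (hRfin.isCompact_biUnion fun q _ => isCompact_closedCell q.1 q.2).inter_left hC
  have hdiff : C \ T = C ∩ ⋃ q : R, closedCell q.1.1 q.1.2 := by
    ext c
    simp only [T, Set.mem_sdiff, Set.mem_inter_iff, Set.mem_iUnion, not_and, not_exists]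
    refine and_congr_right fun hc => ⟨fun h => ?_, ?_⟩
    · have hmem : c ∈ closedCell ⌊c.1⌋ ⌊c.2⌋ :=
        ⟨⟨Int.floor_le _, (Int.lt_floor_add_one _).le⟩, Int.floor_le _,
          (Int.lt_floor_add_one _).le⟩
      by_contra hcon
      exact h hc (⌊c.1⌋, ⌊c.2⌋) (fun hR => hcon ⟨⟨_, hR⟩, hmem⟩) hmem
    · rintro ⟨⟨q, hq⟩, hcq⟩ - q' hq' hcq'
      exact hq' (Reach.of_mem_closedCell (hfar c hc) hq hcq hcq')
  have hT : T = ∅ := hcomp T Set.inter_subset_left hTcomp <| by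
    rw [hdiff]
    exact hC.inter <| (locallyFinite_closedCell.comp_injective
      Subtype.val_injective).isClosed_iUnion fun q => (isCompact_closedCell _ _).isClosed
  obtain ⟨f, hf, hfC⟩ := (avoidable_reach hSc hK hgout).mono (V := C) fun c hc i j hcij => by
    by_contra hR
    exact (hT ▸ Set.notMem_empty c : c ∉ T) ⟨hc, Set.mem_biUnion (x := (i, j)) hR hcij⟩
  exact ⟨f, hf.trans hg, hfC⟩

end UnitGrid

/-- A version of `UnitGrid.avoidable_of_one_lt_dist` in a topological plane. -/
theorem avoidable_of_homeomorph_prod {P E : Type*} [TopologicalSpace P] [SimplyConnectedSpace P]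
    [LocallyPathConnectedSpace P] [TopologicalSpace E] (h : E ≃ₜ ℝ × ℝ) {f₀ : C(P, E)} {S : Set P}
    (hSc : IsConnected S) (hSk : IsCompact S) {C : Set E} (hC : IsClosed C)
    (hcomp : ∀ T ⊆ C, IsCompact T → IsClosed (C \ T) → T = ∅) (hdisj : ∀ x ∈ S, f₀ x ∉ C) :
    Avoidable f₀ S C := by
  obtain ⟨r, hr, hdist⟩ := Metric.exists_pos_forall_lt_edist
    ((hSk.image f₀.continuous).image h.continuous) (h.isClosedMap C hC) (by
      rw [Set.disjoint_left]
      rintro _ ⟨_, ⟨x, hx, rfl⟩, rfl⟩ ⟨c, hc, hxc⟩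
      exact hdisj x hx (h.injective hxc ▸ hc))
  have hr0 : (0 : ℝ) < r := hr
  let k : E ≃ₜ ℝ × ℝ := h.trans (Homeomorph.smulOfNeZero (r : ℝ)⁻¹ (inv_ne_zero hr0.ne'))
  have hk : ∀ x, k x = (r : ℝ)⁻¹ • h x := fun _ => rfl
  obtain ⟨f, hf, hfC⟩ := UnitGrid.avoidable_of_one_lt_dist
    (f₀ := (k : C(E, ℝ × ℝ)).comp f₀) (C := k '' C) hSc hSk (k.isClosedMap C hC) (by
      intro T hTC hT hcl
      have hT' : k ⁻¹' T = ∅ := by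
        refine hcomp _ ?_ ((k.isCompact_preimage).2 hT) ?_
        · intro x hx
          obtain ⟨c, hc, hcx⟩ := hTC hx
          exact k.injective hcx ▸ hc
        · have := hcl.preimage k.continuous
          rwa [Set.preimage_sdiff, k.preimage_image] at this
      rw [← k.image_preimage T, hT', Set.image_empty])
    (by
      rintro x hx _ ⟨c, hc, rfl⟩
      have := hdist _ (Set.mem_image_of_mem h (Set.mem_image_of_mem f₀ hx)) _
        (Set.mem_image_of_mem h hc)
      rw [edist_nndist, ENNReal.coe_lt_coe, ← NNReal.coe_lt_coe, coe_nndist] at this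
      simp only [ContinuousMap.comp_apply, ContinuousMap.coe_coe, hk]
      rw [dist_smul₀, Real.norm_of_nonneg (inv_nonneg.2 hr0.le), ← div_eq_inv_mul,
        one_lt_div hr0]
      exact this)
  refine ⟨(k.symm : C(ℝ × ℝ, E)).comp f, fun x hx => ?_, fun x hx => hfC x ⟨_, hx, ?_⟩⟩
  · simp [hf hx]
  · simp

theorem exists_eq_cos_sin {x : EuclideanSpace ℝ (Fin 2)} (hx : ‖x‖ = 1) :
    ∃ θ : ℝ, x = !₂[Real.cos θ, Real.sin θ] := by
  have h1 := EuclideanSpace.norm_sq_eq x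
  rw [hx, Fin.sum_univ_two, Real.norm_eq_abs, Real.norm_eq_abs, sq_abs, sq_abs] at h1
  set z : ℂ := ⟨x 0, x 1⟩
  have hz : ‖z‖ = 1 := by
    rw [Complex.norm_def, Complex.normSq_mk, Real.sqrt_eq_one]
    linarith
  have hz0 : z ≠ 0 := by
    rw [← norm_ne_zero_iff, hz]
    exact one_ne_zero
  refine ⟨z.arg, ?_⟩
  ext i
  fin_cases i
  · simp [Complex.cos_arg hz0, hz, z]
  · simp [Complex.sin_arg, hz, z]

instance fact_finrank_euclideanSpace_three :
    Fact (Module.finrank ℝ (EuclideanSpace ℝ (Fin 3)) = 2 + 1) := ⟨by simp⟩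

instance tietzeExtension_euclideanSpace (n : ℕ) : TietzeExtension (EuclideanSpace ℝ (Fin n)) :=
  TietzeExtension.of_tvs ℝ

/-- A map into the sphere that misses a point is nullhomotopic. -/
theorem nullhomotopic_of_forall_ne {X : Type*} [TopologicalSpace X]
    (ψ : C(X, Metric.sphere (0 : EuclideanSpace ℝ (Fin 3)) 1))
    (v : Metric.sphere (0 : EuclideanSpace ℝ (Fin 3)) 1) (hψ : ∀ x, ψ x ≠ v) :
    ψ.Nullhomotopic := by
  let s := stereographic' 2 v
  have hsrc : ∀ x, ψ x ∈ s.source := fun x => by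
    rw [stereographic'_source]
    exact hψ x
  let α : C(X, EuclideanSpace ℝ (Fin 2)) :=
    ⟨fun x => s (ψ x), s.continuousOn.comp_continuous ψ.continuous hsrc⟩
  let β : C(EuclideanSpace ℝ (Fin 2), Metric.sphere (0 : EuclideanSpace ℝ (Fin 3)) 1) :=
    ⟨s.symm, (s.symm.isOpenEmbedding (stereographic'_target v)).continuous⟩
  have hψ' : ψ = β.comp α := by
    ext1 x
    exact (s.left_inv (hsrc x)).symm
  rw [hψ']
  exact ((id_nullhomotopic (EuclideanSpace ℝ (Fin 2))).comp_left α).comp_right β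

/-- Radial projection from the punctured space to the sphere. -/
theorem norm_inv_smul_mem_sphere {E : Type*} [NormedAddCommGroup E] [NormedSpace ℝ E] {y : E}
    (hy : y ≠ 0) : ‖y‖⁻¹ • y ∈ Metric.sphere (0 : E) 1 := by
  rw [mem_sphere_zero_iff_norm, norm_smul, norm_inv, norm_norm, inv_mul_cancel₀ (by simpa)]

/-- The two-dimensional sphere is simply connected, in terms of maps from the circle. -/
theorem nullhomotopic_circle_sphere
    (φ : C(Metric.sphere (0 : EuclideanSpace ℝ (Fin 2)) 1,
      Metric.sphere (0 : EuclideanSpace ℝ (Fin 3)) 1)) : φ.Nullhomotopic := by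
  let j : C(Metric.sphere (0 : EuclideanSpace ℝ (Fin 3)) 1, EuclideanSpace ℝ (Fin 3)) :=
    ⟨Subtype.val, continuous_subtype_val⟩
  obtain ⟨f, hf⟩ := ContinuousMap.exists_restrict_eq
    (Metric.isClosed_sphere (x := (0 : EuclideanSpace ℝ (Fin 2))) (ε := 1)) (j.comp φ)
  have hfφ : ∀ x : Metric.sphere (0 : EuclideanSpace ℝ (Fin 2)) 1, f x = φ x :=
    fun x => DFunLike.congr_fun hf x
  obtain ⟨g, hg, hgf, -⟩ := f.continuous.exists_contDiff_approx (ε := fun _ => 1) 1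
    continuous_const fun _ => one_pos
  have hclose : ∀ x : Metric.sphere (0 : EuclideanSpace ℝ (Fin 2)) 1,
      ‖g x - φ x‖ < 1 := fun x => by
    rw [← hfφ, ← dist_eq_norm]
    exact hgf x
  have hne : ∀ (t : unitInterval) (x : Metric.sphere (0 : EuclideanSpace ℝ (Fin 2)) 1),
      (φ x : EuclideanSpace ℝ (Fin 3)) + (t : ℝ) • (g x - φ x) ≠ 0 := by
    intro t x h0
    have h1 : ‖(φ x : EuclideanSpace ℝ (Fin 3))‖ = 1 := mem_sphere_zero_iff_norm.1 (φ x).2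
    rw [eq_neg_of_add_eq_zero_left h0, norm_neg, norm_smul,
      Real.norm_of_nonneg t.2.1] at h1
    nlinarith [hclose x, t.2.1, t.2.2, norm_nonneg (g x - φ x)]
  have hg0 : ∀ x : Metric.sphere (0 : EuclideanSpace ℝ (Fin 2)) 1, g x ≠ 0 := fun x => by
    simpa using hne 1 x
  have hcone : ContDiff ℝ 1 fun q : ℝ × ℝ => q.1 • g !₂[Real.cos q.2, Real.sin q.2] := by
    refine contDiff_fst.smul (hg.comp ?_)
    rw [contDiff_euclidean]
    intro i
    fin_cases i
    · exact Real.contDiff_cos.comp contDiff_snd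
    · exact Real.contDiff_sin.comp contDiff_snd
  obtain ⟨v, hv⟩ := (hcone.dense_compl_range_of_finrank_lt_finrank (by simp)).nonempty
  have hv0 : v ≠ 0 := by
    rintro rfl
    exact hv ⟨(0, 0), by simp⟩
  let ψ : C(Metric.sphere (0 : EuclideanSpace ℝ (Fin 2)) 1,
      Metric.sphere (0 : EuclideanSpace ℝ (Fin 3)) 1) :=
    ⟨fun x => ⟨‖g x‖⁻¹ • g x, norm_inv_smul_mem_sphere (hg0 x)⟩, by
      have hgc : Continuous fun x : Metric.sphere (0 : EuclideanSpace ℝ (Fin 2)) 1 => g x :=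
        hg.continuous.comp continuous_subtype_val
      exact ((hgc.norm.inv₀ fun x => norm_ne_zero_iff.2 (hg0 x)).smul hgc).subtype_mk _⟩
  have hψ : ψ.Nullhomotopic := by
    refine nullhomotopic_of_forall_ne ψ ⟨‖v‖⁻¹ • v, norm_inv_smul_mem_sphere hv0⟩ fun x hx => hv ?_
    obtain ⟨θ, hθ⟩ := exists_eq_cos_sin (mem_sphere_zero_iff_norm.1 x.2)
    refine ⟨(‖v‖ * ‖g x‖⁻¹, θ), ?_⟩
    have hx' : ‖g x‖⁻¹ • g x = ‖v‖⁻¹ • v := congrArg Subtype.val hx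
    simp only
    rw [← hθ, mul_smul, hx', smul_smul, mul_inv_cancel₀ (norm_ne_zero_iff.2 hv0), one_smul]
  obtain ⟨c, hc⟩ := hψ
  refine ⟨c, ContinuousMap.Homotopic.trans ⟨⟨⟨fun q => ⟨_, norm_inv_smul_mem_sphere
    (hne q.1 q.2)⟩, ?_⟩, fun x => ?_, fun x => ?_⟩⟩ hc⟩
  · have hgc : Continuous g := hg.continuous
    have hcont : Continuous fun q : unitInterval × Metric.sphere (0 : EuclideanSpace ℝ (Fin 2)) 1 =>
        (φ q.2 : EuclideanSpace ℝ (Fin 3)) + (q.1 : ℝ) • (g q.2 - φ q.2) := by fun_prop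
    exact ((hcont.norm.inv₀ fun q => norm_ne_zero_iff.2 (hne q.1 q.2)).smul hcont).subtype_mk _
  · ext1
    have h1 : ‖(φ x : EuclideanSpace ℝ (Fin 3))‖ = 1 := mem_sphere_zero_iff_norm.1 (φ x).2
    simp [h1]
  · ext1
    simp [ψ]

theorem exists_isOpenEmbedding_range_eq_compl {Z : Type*} [TopologicalSpace Z]
    (e : Z ≃ₜ Metric.sphere (0 : EuclideanSpace ℝ (Fin 3)) 1) (a : Z) :
    ∃ s : EuclideanSpace ℝ (Fin 2) → Z, Topology.IsOpenEmbedding s ∧ Set.range s = {a}ᶜ := by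
  let s := (stereographic' 2 (e a)).symm
  have hs : s.source = Set.univ := stereographic'_target (e a)
  refine ⟨e.symm ∘ s, e.symm.isOpenEmbedding.comp (s.isOpenEmbedding hs), ?_⟩
  have hrange : Set.range s = {e a}ᶜ := by
    rw [← Set.image_univ, ← hs, s.image_source_eq_target]
    exact stereographic'_source (e a)
  rw [Set.range_comp, hrange, Set.image_compl_eq e.symm.bijective, Set.image_singleton,
    e.symm_apply_apply]

/-- A loop in a topological sphere is nullhomotopic in the complement of a connected set that it
misses. -/
theorem exists_homotopy_notMem_of_isPreconnected {Z : Type*} [TopologicalSpace Z]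
    (hZ : Nonempty (Z ≃ₜ Metric.sphere (0 : EuclideanSpace ℝ (Fin 3)) 1)) {C : Set Z}
    (hC : IsClosed C) (hCc : IsPreconnected C)
    (φ : C(Metric.sphere (0 : EuclideanSpace ℝ (Fin 2)) 1, Z)) (hφ : ∀ x, φ x ∉ C) :
    ∃ (c : Z) (H : ContinuousMap.Homotopy φ (ContinuousMap.const _ c)), ∀ q, H q ∉ C := by
  obtain ⟨e⟩ := hZ
  rcases C.eq_empty_or_nonempty with rfl | ⟨a, ha⟩
  · let k : C(Z, Metric.sphere (0 : EuclideanSpace ℝ (Fin 3)) 1) := ⟨e, e.continuous⟩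
    let l : C(Metric.sphere (0 : EuclideanSpace ℝ (Fin 3)) 1, Z) := ⟨e.symm, e.symm.continuous⟩
    have hnull := (nullhomotopic_circle_sphere (k.comp φ)).comp_right l
    have hφe : l.comp (k.comp φ) = φ := by
      ext1 x
      simp [k, l]
    rw [hφe] at hnull
    obtain ⟨c, ⟨H⟩⟩ := hnull
    exact ⟨c, H, fun _ => Set.notMem_empty _⟩
  have : T2Space Z := e.symm.t2Space
  obtain ⟨s, hs, hrange⟩ := exists_isOpenEmbedding_range_eq_compl e a
  have hsa : ∀ y, s y ≠ a := fun y => by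
    have : s y ∈ Set.range s := ⟨y, rfl⟩
    rwa [hrange] at this
  have hrng : ∀ z, z ≠ a → ∃ y, s y = z := fun z hz => by
    have : z ∈ Set.range s := by rw [hrange]; exact hz
    exact this
  choose φ' hφ' using fun x => hrng (φ x) fun h => hφ x (h ▸ ha)
  have hφ'c : Continuous φ' := by
    rw [hs.isInducing.continuous_iff, show s ∘ φ' = φ from funext hφ']
    exact φ.continuous
  obtain ⟨f₀, hf₀⟩ := ContinuousMap.exists_restrict_eq
    (Metric.isClosed_sphere (x := (0 : EuclideanSpace ℝ (Fin 2))) (ε := 1)) ⟨φ', hφ'c⟩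
  have hf₀φ : ∀ x : Metric.sphere (0 : EuclideanSpace ℝ (Fin 2)) 1, f₀ x = φ' x :=
    fun x => DFunLike.congr_fun hf₀ x
  have hcomp : ∀ T ⊆ s ⁻¹' C, IsCompact T → IsClosed ((s ⁻¹' C) \ T) → T = ∅ := by
    intro T hTC hT hcl
    by_contra hne
    obtain ⟨y, hy⟩ := Set.nonempty_iff_ne_empty.2 hne
    have hO : IsClosed (s '' ((s ⁻¹' C) \ T)ᶜ)ᶜ :=
      (hs.isOpenMap _ hcl.isOpen_compl).isClosed_compl
    obtain ⟨z, -, ⟨y', hy', rfl⟩, hz⟩ := isPreconnected_closed_iff.1 hCc _ _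
      (hT.image hs.continuous).isClosed hO (by
        intro z hz
        by_cases hzT : z ∈ s '' T
        · exact Or.inl hzT
        · refine Or.inr ?_
          rintro ⟨y', hy', rfl⟩
          exact hy' ⟨hz, fun h => hzT ⟨y', h, rfl⟩⟩)
      ⟨s y, hTC hy, y, hy, rfl⟩ ⟨a, ha, fun ⟨y', _, h⟩ => hsa y' h⟩
    exact hz ⟨y', fun h => h.2 hy', rfl⟩
  obtain ⟨f, hf, hfC⟩ := avoidable_of_homeomorph_prod (f₀ := f₀)
    ((EuclideanSpace.equiv (Fin 2) ℝ).toHomeomorph.trans Homeomorph.finTwoArrow)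
    (isConnected_sphere (by
      rw [← Module.finrank_eq_rank, finrank_euclideanSpace_fin]
      norm_num) (0 : EuclideanSpace ℝ (Fin 2)) zero_le_one)
    (isCompact_sphere _ _) (hC.preimage hs.continuous) hcomp (by
      intro x hx
      rw [Set.mem_preimage, hf₀φ ⟨x, hx⟩, hφ']
      exact hφ _)
  refine ⟨s (f 0), ⟨⟨fun q => s (f ((1 - (q.1 : ℝ)) • (q.2 : EuclideanSpace ℝ (Fin 2)))), ?_⟩,
    fun x => ?_, fun x => ?_⟩, fun q => hfC _⟩
  · exact hs.continuous.comp (f.continuous.comp (by fun_prop))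
  · simp [hf x.2, hf₀φ, hφ']
  · simp

/-- If a metric space `Z` homeomorphic to the 2-sphere is `λ`-LLC, then every continuous
loop `φ : S¹ → Z` with image in a ball `B(p,R)` is null-homotopic in `B(p, λR)`. -/
theorem stmt_14 (Z : Type*) [MetricSpace Z]
    (hZ : Nonempty (Z ≃ₜ ↥(Metric.sphere (0 : EuclideanSpace ℝ (Fin 3)) 1)))
    (lam : ℝ) (hlam : 1 ≤ lam) (hLLC : IsLLC Z lam)
    (φ : C(↥(Metric.sphere (0 : EuclideanSpace ℝ (Fin 2)) 1), Z))
    (p : Z) (R : ℝ) (hφ : ∀ x, φ x ∈ Metric.ball p R) :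
    ∃ (c : Z) (H : ContinuousMap.Homotopy φ (ContinuousMap.const _ c)),
      ∀ (t : unitInterval) (x : ↥(Metric.sphere (0 : EuclideanSpace ℝ (Fin 2)) 1)),
        H (t, x) ∈ Metric.ball p (lam * R) := by
  suffices h : ∃ C : Set Z, IsClosed C ∧ IsPreconnected C ∧ C ⊆ (Metric.ball p R)ᶜ ∧
      (Metric.ball p (lam * R))ᶜ ⊆ C by
    obtain ⟨C, hC, hCc, hCR, hC'⟩ := h
    obtain ⟨c, H, hH⟩ := exists_homotopy_notMem_of_isPreconnected hZ hC hCc φ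
      fun x hx => hCR hx (hφ x)
    exact ⟨c, H, fun t x => by_contra fun h => hH _ (hC' h)⟩
  rcases (Metric.ball p (lam * R))ᶜ.eq_empty_or_nonempty with hA | ⟨a, ha⟩
  · exact ⟨∅, isClosed_empty, isPreconnected_empty, Set.empty_subset _, hA.subset⟩
  refine ⟨closure (connectedComponentIn (Metric.ball p R)ᶜ a), isClosed_closure,
    isPreconnected_connectedComponentIn.closure,
    closure_minimal (connectedComponentIn_subset _ _) Metric.isOpen_ball.isClosed_compl,
    fun b hb => subset_closure ?_⟩
  obtain ⟨E, hE, hER, haE, hbE⟩ := hLLC.2 p (lam * R) a ha b hb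
  rw [mul_div_cancel_left₀ R (by linarith : lam ≠ 0)] at hER
  exact hE.2.1.isPreconnected.subset_connectedComponentIn haE hER hbE
end
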